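/- For every natural number n such that 24 divides 7n+1, the number spt((7n+1)/24) is divisible by 7. -/

import Mathlib

open Finset

/-- `spt n`: the total number of smallest parts in the partitions of `n`,
i.e. the sum over all partitions of `n` of the multiplicity of the smallest part. -/
def spt (n : ℕ) : ℕ :=
  ∑ p : Nat.Partition n, (p.parts.filter (fun j => ∀ i ∈ p.parts, j ≤ i)).card

namespace SptModSeven

/-! ### Partial fractions of the inverse cube of a product of linear factors -/

section PartialFractions

open Polynomial

variable {K : Type*} [Field K]

theorem pow_three_dvd_prod_sub (x : ℕ → K) (h2 : (2 : K) ≠ 0) {n : ℕ} (hn : x n ≠ 0)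
    (t : Finset ℕ) (ht : ∀ m ∈ t, x m ≠ x n) :
    (1 - C (x n) * X : K[X]) ^ 3 ∣ ∏ m ∈ t, (1 - C (x m) * X) -
      C (∏ m ∈ t, (1 - x m / x n)) * (1 + C (∑ m ∈ t, x m / (x n - x m)) * (1 - C (x n) * X)
        + C (((∑ m ∈ t, x m / (x n - x m)) ^ 2 - ∑ m ∈ t, (x m / (x n - x m)) ^ 2) / 2)
          * (1 - C (x n) * X) ^ 2) := by
  induction t using Finset.induction_on with
  | empty => simp
  | insert i t hi ih =>
    obtain ⟨w, hw⟩ := ih fun m hm => ht m (mem_insert_of_mem hm)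
    have hne : x n - x i ≠ 0 := sub_ne_zero.2 (ht i (mem_insert_self _ _)).symm
    rw [prod_insert hi, prod_insert hi, sum_insert hi, sum_insert hi]
    set b := ∑ m ∈ t, x m / (x n - x m)
    set d := ∑ m ∈ t, (x m / (x n - x m)) ^ 2
    set c := ∏ m ∈ t, (1 - x m / x n)
    set e := x i / (x n - x i) with he
    have hu : (1 - C (x i) * X : K[X]) =
        C (1 - x i / x n) * (1 + C e * (1 - C (x n) * X)) := by
      have h1 : (1 - x i / x n) * (1 + e) = 1 := by rw [he]; field_simp; ring
      have h3 : (1 - x i / x n) * (e * x n) = x i := by rw [he]; field_simp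
      have h1' := congrArg (C : K → K[X]) h1
      have h3' := congrArg (C : K → K[X]) h3
      simp only [map_mul, map_add, map_one] at h1' h3' ⊢
      linear_combination X * h3' - h1'
    have hf : ((e + b) ^ 2 - (e ^ 2 + d)) / 2 = (b ^ 2 - d) / 2 + b * e := by
      field_simp; ring
    rw [hf, sub_eq_iff_eq_add.1 hw, hu]
    refine ⟨C (1 - x i / x n) * ((1 + C e * (1 - C (x n) * X)) * w +
      C c * (C e * C ((b ^ 2 - d) / 2))), ?_⟩
    simp only [map_mul, map_add]
    ring

theorem pow_three_dvd_aux {R : Type*} [CommRing R] {u c a B D F G w : R} (hca : a * c = 1)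
    (hF : 2 * F = B ^ 2 - D) (hG : 2 * G = 9 * B ^ 2 + 3 * D) (h2 : IsUnit (2 : R)) :
    u ^ 3 ∣ a ^ 3 * (1 - 3 * B * u + G * u ^ 2) *
      (c * (1 + B * u + F * u ^ 2) + u ^ 3 * w) ^ 3 - 1 := by
  have hz : 3 * (B ^ 2 + F) - 9 * B ^ 2 + G = 0 := by
    refine h2.mul_left_cancel ?_
    linear_combination 3 * hF + hG
  have hca3 : a ^ 3 * c ^ 3 = 1 := by rw [← mul_pow, hca, one_pow]
  have h1 : u ^ 3 ∣ (1 - 3 * B * u + G * u ^ 2) * (1 + B * u + F * u ^ 2) ^ 3 - 1 := by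
    refine ⟨(3 * B * G - 9 * B * (B ^ 2 + F)) + G * 3 * (B ^ 2 + F) * u +
      (1 - 3 * B * u + G * u ^ 2) * ((B ^ 3 + 6 * B * F) + (3 * F ^ 2 + 3 * B ^ 2 * F) * u +
        3 * B * F ^ 2 * u ^ 2 + F ^ 3 * u ^ 3), ?_⟩
    linear_combination u ^ 2 * hz
  obtain ⟨v, hv⟩ := h1
  refine ⟨v + a ^ 3 * (1 - 3 * B * u + G * u ^ 2) * (3 * (c * (1 + B * u + F * u ^ 2)) ^ 2 * w +
    3 * (c * (1 + B * u + F * u ^ 2)) * u ^ 3 * w ^ 2 + u ^ 6 * w ^ 3), ?_⟩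
  linear_combination hv +
    (1 - 3 * B * u + G * u ^ 2) * (1 + B * u + F * u ^ 2) ^ 3 * hca3

theorem sum_partialFraction_cube (x : ℕ → K) (h2 : (2 : K) ≠ 0) {s : Finset ℕ}
    (hs : s.Nonempty) (h0 : ∀ n ∈ s, x n ≠ 0) (hx : Set.InjOn x s) :
    ∑ n ∈ s, C ((∏ m ∈ s.erase n, (1 - x m / x n)⁻¹) ^ 3) *
      (1 - 3 * C (∑ m ∈ s.erase n, x m / (x n - x m)) * (1 - C (x n) * X) +
        C ((9 * (∑ m ∈ s.erase n, x m / (x n - x m)) ^ 2 +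
          3 * ∑ m ∈ s.erase n, (x m / (x n - x m)) ^ 2) / 2) * (1 - C (x n) * X) ^ 2) *
      (∏ m ∈ s.erase n, (1 - C (x m) * X)) ^ 3 = (1 : K[X]) := by
  have hne : ∀ n ∈ s, ∀ m ∈ s.erase n, x m ≠ x n := fun n hn m hm h =>
    (mem_erase.1 hm).1 (hx (mem_of_mem_erase hm) hn h)
  set f : ℕ → K[X] := fun n => C ((∏ m ∈ s.erase n, (1 - x m / x n)⁻¹) ^ 3) *
      (1 - 3 * C (∑ m ∈ s.erase n, x m / (x n - x m)) * (1 - C (x n) * X) +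
        C ((9 * (∑ m ∈ s.erase n, x m / (x n - x m)) ^ 2 +
          3 * ∑ m ∈ s.erase n, (x m / (x n - x m)) ^ 2) / 2) * (1 - C (x n) * X) ^ 2) with hf
  set p : ℕ → K[X] := fun n => ∏ m ∈ s.erase n, (1 - C (x m) * X) with hp
  have hlocal : ∀ n ∈ s, (1 - C (x n) * X) ^ 3 ∣ f n * p n ^ 3 - 1 := by
    intro n hn
    obtain ⟨w, hw⟩ := pow_three_dvd_prod_sub x h2 (h0 n hn) (s.erase n) (hne n hn)
    have hc : (∏ m ∈ s.erase n, (1 - x m / x n)⁻¹) * ∏ m ∈ s.erase n, (1 - x m / x n) = 1 := by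
      rw [← prod_mul_distrib]
      refine prod_eq_one fun m hm => inv_mul_cancel₀ ?_
      rw [sub_ne_zero, ne_comm, Ne, div_eq_one_iff_eq (h0 n hn)]
      exact hne n hn m hm
    simp only [hf, hp]
    rw [sub_eq_iff_eq_add.1 hw, add_comm (_ * w), C_pow]
    refine pow_three_dvd_aux (D := C (∑ m ∈ s.erase n, (x m / (x n - x m)) ^ 2)) ?_ ?_ ?_ ?_
    · rw [← C_mul, hc, C_1]
    · rw [← C_pow, ← C_sub, show (2 : K[X]) = C 2 from rfl, ← C_mul, mul_div_cancel₀ _ h2]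
    · rw [show (2 : K[X]) = C 2 from rfl, show (3 : K[X]) = C 3 from rfl,
        show (9 : K[X]) = C 9 from rfl]
      simp only [← C_pow, ← C_mul, ← C_add]
      rw [mul_div_cancel₀ _ h2]
    · exact isUnit_C.2 (isUnit_iff_ne_zero.2 h2)
  have hdvd : ∏ n ∈ s, (1 - C (x n) * X : K[X]) ^ 3 ∣ ∑ n ∈ s, f n * p n ^ 3 - 1 := by
    refine Finset.prod_dvd_of_coprime ?_ ?_
    · intro i hi j hj hij
      refine IsCoprime.pow ?_
      have hd : x j - x i ≠ 0 := sub_ne_zero.2 fun h => hij (hx hj hi h).symm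
      refine ⟨C (x j / (x j - x i)), -C (x i / (x j - x i)), ?_⟩
      have e1 := congrArg (C : K → K[X])
        (show x j / (x j - x i) - x i / (x j - x i) = 1 by field_simp)
      have e2 := congrArg (C : K → K[X])
        (show x j / (x j - x i) * x i = x i / (x j - x i) * x j by ring)
      simp only [C_mul, C_sub, C_1] at e1 e2
      linear_combination e1 - X * e2
    · intro n hn
      rw [← add_sum_erase s _ hn, add_sub_right_comm]
      refine dvd_add (hlocal n hn) (dvd_sum fun m hm => Dvd.dvd.mul_left ?_ _)
      refine pow_dvd_pow_of_dvd ?_ 3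
      exact dvd_prod_of_mem _ (mem_erase.2 ⟨(mem_erase.1 hm).1.symm, hn⟩)
  have hdeg : ∀ n ∈ s, (1 - C (x n) * X : K[X]).natDegree = 1 := by
    intro n hn
    rw [show (1 - C (x n) * X : K[X]) = C (-x n) * X + C 1 by simp; ring]
    exact natDegree_linear (neg_ne_zero.2 (h0 n hn))
  have hcard : (∏ n ∈ s, (1 - C (x n) * X : K[X]) ^ 3).natDegree = 3 * s.card := by
    rw [natDegree_prod]
    · rw [sum_congr rfl fun n hn => by rw [natDegree_pow, hdeg n hn], sum_const, smul_eq_mul]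
      ring
    · intro n hn h
      have := hdeg n hn
      rw [pow_eq_zero_iff (by norm_num)] at h
      simp [h] at this
  have hlt : (∑ n ∈ s, f n * p n ^ 3 - 1).natDegree ≤ 3 * s.card - 1 := by
    refine (natDegree_sub_le _ _).trans (max_le ?_ (by simp))
    refine natDegree_sum_le_of_forall_le _ _ fun n hn => ?_
    have hu : (1 - C (x n) * X : K[X]).natDegree ≤ 1 := (hdeg n hn).le
    have hfn : (f n).natDegree ≤ 2 := by
      simp only [hf]
      have e : (1 - C (x n) * X : K[X]).natDegree = 1 := hdeg n hn
      refine (natDegree_C_mul_le _ _).trans ?_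
      refine (natDegree_add_le _ _).trans (max_le ?_ ?_)
      · refine (natDegree_sub_le _ _).trans (max_le (by simp) ?_)
        rw [show (3 : K[X]) = C 3 from rfl, ← C_mul]
        exact (natDegree_C_mul_le _ _).trans (by omega)
      · refine (natDegree_C_mul_le _ _).trans (natDegree_pow_le.trans (by omega))
    have hpn : (p n).natDegree ≤ s.card - 1 := by
      simp only [hp]
      refine (natDegree_prod_le _ _).trans ?_
      rw [sum_congr rfl fun m hm => hdeg m (mem_of_mem_erase hm), sum_const, smul_eq_mul, mul_one,
        card_erase_of_mem hn]
    have hpos : 0 < s.card := hs.card_pos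
    refine natDegree_mul_le.trans ?_
    have := natDegree_pow_le (p := p n) (n := 3)
    omega
  have hzero := eq_zero_of_dvd_of_natDegree_lt hdvd (by
    have hpos : 0 < s.card := hs.card_pos
    rw [hcard]; omega)
  exact sub_eq_zero.1 hzero

end PartialFractions

section Coefficients

open PowerSeries

variable {K : Type*} [Field K]

theorem mk_pow_mul (x : K) : mk (fun k => x ^ k) * (1 - C x * X) = (1 : K⟦X⟧) := by
  ext k
  rcases k with _ | k
  · simp
  · rw [mul_sub, mul_one, mul_left_comm, map_sub, coeff_C_mul, coeff_succ_mul_X]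
    simp [coeff_one]; ring

theorem mk_succ_mul (x : K) :
    mk (fun k => (k + 1) * x ^ k) * (1 - C x * X) = (mk fun k => x ^ k : K⟦X⟧) := by
  ext k
  rcases k with _ | k
  · simp
  · rw [mul_sub, mul_one, mul_left_comm, map_sub, coeff_C_mul, coeff_succ_mul_X]
    simp; ring

theorem mk_choose_mul (x : K) (h2 : (2 : K) ≠ 0) :
    mk (fun k => (k + 2) * (k + 1) / 2 * x ^ k) * (1 - C x * X) =
      (mk fun k => (k + 1) * x ^ k : K⟦X⟧) := by
  ext k
  rcases k with _ | k
  · simp [h2]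
  · rw [mul_sub, mul_one, mul_left_comm, map_sub, coeff_C_mul, coeff_succ_mul_X]
    simp; field_simp; ring

theorem coeff_prod_pow_four (h7 : CharP K 7) (x : ℕ → K) {s : Finset ℕ} (hs : s.Nonempty)
    (h0 : ∀ n ∈ s, x n ≠ 0) (hx : Set.InjOn x s) {k : ℕ} (hk : k < 7) :
    coeff k ((∏ n ∈ s, (1 - C (x n) * X)) ^ 4) =
      ∑ n ∈ s, x n ^ k * (∏ m ∈ s.erase n, (1 - x m / x n)⁻¹) ^ 3 *
        ((k + 2) * (k + 1) / 2 - 3 * (k + 1) * (∑ m ∈ s.erase n, x m / (x n - x m)) +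
          (9 * (∑ m ∈ s.erase n, x m / (x n - x m)) ^ 2 +
            3 * ∑ m ∈ s.erase n, (x m / (x n - x m)) ^ 2) / 2) := by
  have h2 : (2 : K) ≠ 0 := by
    have := CharP.cast_eq_zero_iff K 7 2
    norm_num at this; exact this
  have hpf := congrArg (Polynomial.coeToPowerSeries.ringHom (R := K))
    (sum_partialFraction_cube x h2 hs h0 hx)
  simp only [map_sum, map_mul, map_one, map_add, map_sub, map_pow, map_prod, map_ofNat,
    Polynomial.coeToPowerSeries.ringHom_apply, Polynomial.coe_C, Polynomial.coe_X] at hpf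
  have key : (∏ n ∈ s, (1 - C (x n) * X)) ^ 4 = (∏ n ∈ s, (1 - C (x n) * X)) ^ 7 *
      ∑ n ∈ s, C ((∏ m ∈ s.erase n, (1 - x m / x n)⁻¹) ^ 3) *
        (mk (fun k => (k + 2) * (k + 1) / 2 * x n ^ k)
          - C (3 * ∑ m ∈ s.erase n, x m / (x n - x m)) * mk (fun k => (k + 1) * x n ^ k)
          + C ((9 * (∑ m ∈ s.erase n, x m / (x n - x m)) ^ 2 +
            3 * ∑ m ∈ s.erase n, (x m / (x n - x m)) ^ 2) / 2) * mk (fun k => x n ^ k)) := by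
    have h43 : ∀ z w v : K⟦X⟧, w = 1 → w = z ^ 3 * v → z ^ 4 = z ^ 7 * v := by
      intro z w v h h'
      linear_combination z ^ 4 * h' - z ^ 4 * h
    refine h43 _ _ _ hpf ?_
    rw [mul_sum]
    refine sum_congr rfl fun n hn => ?_
    rw [← mul_prod_erase s _ hn]
    have e1 := mk_pow_mul (x n)
    have e2 := mk_succ_mul (x n)
    have e3 := mk_choose_mul (x n) h2
    set u : K⟦X⟧ := 1 - C (x n) * X
    set p : K⟦X⟧ := ∏ m ∈ s.erase n, (1 - C (x m) * X)
    rw [← e2] at e1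
    rw [← e3] at e1 e2
    set v : K⟦X⟧ := mk (fun k : ℕ => ((k : K) + 2) * (k + 1) / 2 * x n ^ k)
    rw [← e2, ← e3]
    simp only [map_mul, map_pow, map_prod, map_sum, map_ofNat]
    set a := ∏ m ∈ s.erase n, C (1 - x m / x n)⁻¹
    set g := C ((9 * (∑ m ∈ s.erase n, x m / (x n - x m)) ^ 2 +
            3 * ∑ m ∈ s.erase n, (x m / (x n - x m)) ^ 2) / 2)
    set b := ∑ m ∈ s.erase n, C (x m / (x n - x m))
    linear_combination -a ^ 3 * p ^ 3 * (1 - 3 * b * u + g * u ^ 2) * e1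
  have hchar : CharP K⟦X⟧ 7 := charP_of_injective_algebraMap (R := K) (C_injective) 7
  have hfr : ∃ w, (∏ n ∈ s, (1 - C (x n) * X : K⟦X⟧)) ^ 7 = 1 + X ^ 7 * w := by
    have : Fact (Nat.Prime 7) := ⟨by norm_num⟩
    rw [← prod_pow]
    clear key hpf hs h0 hx
    induction s using Finset.induction_on with
    | empty => exact ⟨0, by simp⟩
    | insert i t hi ih =>
      obtain ⟨w, hw⟩ := ih
      rw [prod_insert hi, hw, sub_pow_char, one_pow, mul_pow]
      exact ⟨w - C (x i) ^ 7 * (1 + X ^ 7 * w), by ring⟩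
  obtain ⟨w, hw⟩ := hfr
  rw [key, hw, add_mul, one_mul, mul_assoc, map_add, coeff_X_pow_mul', if_neg (by omega), add_zero,
    map_sum]
  refine sum_congr rfl fun n _ => ?_
  simp only [coeff_C_mul, map_add, map_sub, coeff_mk]
  ring

end Coefficients

section ClosedForms

/-- The finite `q`-factorial `(1 - q)(1 - q ^ 2) ⋯ (1 - q ^ n)`. -/
def qFactorial {R : Type*} [CommRing R] (q : R) (n : ℕ) : R := ∏ i ∈ range n, (1 - q ^ (i + 1))

theorem qFactorial_zero {R : Type*} [CommRing R] (q : R) : qFactorial q 0 = 1 := rfl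

theorem qFactorial_succ {R : Type*} [CommRing R] (q : R) (n : ℕ) :
    qFactorial q (n + 1) = qFactorial q n * (1 - q ^ (n + 1)) := prod_range_succ _ _

theorem map_qFactorial {R S : Type*} [CommRing R] [CommRing S] (f : R →+* S) (q : R) (n : ℕ) :
    f (qFactorial q n) = qFactorial (f q) n := by simp [qFactorial]

variable {K : Type*} [Field K] {q : K}

theorem qFactorial_ne_zero (hq : ∀ j, q ^ (j + 1) ≠ 1) (n : ℕ) : qFactorial q n ≠ 0 :=
  prod_ne_zero_iff.2 fun i _ => sub_ne_zero.2 (hq i).symm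

theorem one_add_pow_ne_zero (hq : ∀ j, q ^ (j + 1) ≠ 1) (n : ℕ) : 1 + q ^ (n + 1) ≠ 0 := by
  intro h
  apply hq (2 * n + 1)
  rw [show 2 * n + 1 + 1 = (n + 1) + (n + 1) by ring, pow_add]
  linear_combination (q ^ (n + 1) - 1) * h

/-- The quantity `q ^ n / (1 - q ^ n) ^ 2`. -/
def node (q : K) (n : ℕ) : K := q ^ n / (1 - q ^ n) ^ 2

theorem node_ne_zero (hq0 : q ≠ 0) (hq : ∀ j, q ^ (j + 1) ≠ 1) (n : ℕ) : node q (n + 1) ≠ 0 :=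
  div_ne_zero (pow_ne_zero _ hq0) (pow_ne_zero _ (sub_ne_zero.2 (hq n).symm))

theorem range_succ_erase {n N : ℕ} (h : n < N) :
    (range (N + 1)).erase n = insert N ((range N).erase n) := by
  rw [range_add_one, erase_insert_of_ne h.ne']

theorem range_succ_erase_self (n : ℕ) : (range (n + 1)).erase n = range n := by
  rw [range_add_one, erase_insert (by simp)]

theorem one_sub_node_div_above (hq0 : q ≠ 0) (hq : ∀ j, q ^ (j + 1) ≠ 1) (n i : ℕ) :
    (1 - node q (n + 1 + (i + 1)) / node q (n + 1))⁻¹ =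
      (1 - q ^ (n + 1 + (i + 1))) ^ 2 / ((1 - q ^ (i + 1)) *
        (1 - q ^ (n + 1 + (n + 1) + (i + 1)))) := by
  have h1 := sub_ne_zero.2 (hq n).symm
  have h2 := sub_ne_zero.2 (hq i).symm
  have h3 := sub_ne_zero.2 (hq (n + 1 + i)).symm
  have h4 := sub_ne_zero.2 (hq (n + 1 + (n + 1) + i)).symm
  rw [add_assoc _ i 1, pow_add q (n + 1) (i + 1)] at h3
  rw [add_assoc _ i 1, pow_add q _ (i + 1), pow_add q (n + 1)] at h4
  rw [node, node, pow_add q _ (i + 1), pow_add q _ (i + 1), pow_add q (n + 1) (n + 1)]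
  have hp : q ^ (n + 1) ≠ 0 := pow_ne_zero _ hq0
  generalize q ^ (n + 1) = p at *
  generalize q ^ (i + 1) = y at *
  have : 1 - p * y / (1 - p * y) ^ 2 / (p / (1 - p) ^ 2) =
    (1 - y) * (1 - p * p * y) / (1 - p * y) ^ 2 := by
    field_simp; ring
  rw [this, inv_div]

theorem one_sub_node_div_below (hq0 : q ≠ 0) (hq : ∀ j, q ^ (j + 1) ≠ 1) (n i : ℕ) :
    (1 - node q (n + 1) / node q (n + 1 + (i + 1)))⁻¹ =
      -q ^ (i + 1) * (1 - q ^ (n + 1)) ^ 2 / ((1 - q ^ (i + 1)) *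
        (1 - q ^ (n + 1 + (n + 1) + (i + 1)))) := by
  have h1 := sub_ne_zero.2 (hq n).symm
  have h2 := sub_ne_zero.2 (hq i).symm
  have h3 := sub_ne_zero.2 (hq (n + 1 + i)).symm
  have h4 := sub_ne_zero.2 (hq (n + 1 + (n + 1) + i)).symm
  rw [add_assoc _ i 1, pow_add q (n + 1) (i + 1)] at h3
  rw [add_assoc _ i 1, pow_add q _ (i + 1), pow_add q (n + 1)] at h4
  rw [node, node, pow_add q _ (i + 1), pow_add q _ (i + 1), pow_add q (n + 1) (n + 1)]
  have hp : q ^ (n + 1) ≠ 0 := pow_ne_zero _ hq0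
  have hy : q ^ (i + 1) ≠ 0 := pow_ne_zero _ hq0
  generalize q ^ (n + 1) = p at *
  generalize q ^ (i + 1) = y at *
  have : 1 - p / (1 - p) ^ 2 / (p * y / (1 - p * y) ^ 2) =
    (1 - y) * (1 - p * p * y) / (-y * (1 - p) ^ 2) := by
    field_simp; ring
  rw [this, inv_div]

theorem node_injOn (hq0 : q ≠ 0) (hq : ∀ j, q ^ (j + 1) ≠ 1) :
    Function.Injective fun n => node q (n + 1) := by
  have key : ∀ n i, node q (n + 1) ≠ node q (n + 1 + (i + 1)) := by
    intro n i h
    have h' := one_sub_node_div_above hq0 hq n i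
    rw [← h, div_self (node_ne_zero hq0 hq n), sub_self, inv_zero] at h'
    refine div_ne_zero (pow_ne_zero 2 (sub_ne_zero.2 (hq (n + 1 + i)).symm))
      (mul_ne_zero (sub_ne_zero.2 (hq i).symm)
        (sub_ne_zero.2 (hq (n + 1 + (n + 1) + i)).symm)) h'.symm
  intro m n h
  rcases lt_trichotomy m n with hmn | hmn | hmn
  · obtain ⟨i, rfl⟩ := Nat.exists_eq_add_of_lt hmn
    exact (key m i (by simpa [add_assoc, add_left_comm, add_comm] using h)).elim
  · exact hmn
  · obtain ⟨i, rfl⟩ := Nat.exists_eq_add_of_lt hmn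
    exact (key n i (by simpa [add_assoc, add_left_comm, add_comm] using h.symm)).elim

theorem prod_erase_inv_one_sub_node (hq0 : q ≠ 0) (hq : ∀ j, q ^ (j + 1) ≠ 1) (n d : ℕ) :
    ∏ m ∈ (range (n + 1 + d)).erase n, (1 - node q (m + 1) / node q (n + 1))⁻¹ =
      (-1) ^ n * q ^ (n * (n + 1) / 2) * (1 + q ^ (n + 1)) *
        (qFactorial q (n + 1 + d) ^ 2 / (qFactorial q d * qFactorial q (n + 1 + d + (n + 1)))) := by
  have hF := qFactorial_ne_zero hq
  induction d with
  | zero =>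
    rw [add_zero, range_succ_erase_self]
    have hterm : ∀ m ∈ range n, (1 - node q (m + 1) / node q (n + 1))⁻¹ =
        -q ^ (n - 1 - m + 1) * (1 - q ^ (m + 1)) ^ 2 / ((1 - q ^ (n - 1 - m + 1)) *
          (1 - q ^ (n + 1 + m + 1))) := by
      intro m hm
      have h := one_sub_node_div_below hq0 hq m (n - 1 - m)
      have hmn := mem_range.1 hm
      rwa [show m + 1 + (n - 1 - m + 1) = n + 1 by omega,
        show m + 1 + (m + 1) + (n - 1 - m + 1) = n + 1 + m + 1 by omega] at h
    rw [prod_congr rfl hterm, prod_div_distrib, prod_mul_distrib, prod_mul_distrib,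
      prod_range_reflect (fun i => -q ^ (i + 1)), prod_range_reflect (fun i => 1 - q ^ (i + 1)),
      prod_pow, ← qFactorial, qFactorial_zero]
    have hsign : ∏ i ∈ range n, (-q ^ (i + 1)) = (-1) ^ n * q ^ (n * (n + 1) / 2) := by
      clear hterm
      induction n with
      | zero => simp
      | succ n ih =>
        rw [prod_range_succ, ih, show (n + 1) * (n + 1 + 1) / 2 = n * (n + 1) / 2 + (n + 1) by
          have := Nat.triangle_succ (n + 1)
          simpa [mul_comm] using this]
        ring
    have htail : qFactorial q (n + 1 + n) =
        qFactorial q (n + 1) * ∏ m ∈ range n, (1 - q ^ (n + 1 + m + 1)) := prod_range_add _ _ _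
    rw [hsign, ← add_assoc, qFactorial_succ q (n + 1 + n), htail, qFactorial_succ]
    have h1 := sub_ne_zero.2 (hq n).symm
    have h2 := one_add_pow_ne_zero hq n
    have h3 : ∏ m ∈ range n, (1 - q ^ (n + 1 + m + 1)) ≠ 0 :=
      prod_ne_zero_iff.2 fun m _ => sub_ne_zero.2 (hq (n + 1 + m)).symm
    have h4 : 1 - q ^ (n + 1 + n + 1) = (1 - q ^ (n + 1)) * (1 + q ^ (n + 1)) := by ring
    have := hF n
    rw [h4]
    field_simp
  | succ d ih =>
    rw [← add_assoc, range_succ_erase (by omega), prod_insert (by simp), ih]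
    have := one_sub_node_div_above hq0 hq n d
    rw [show n + 1 + d + 1 = n + 1 + (d + 1) by ring, this,
      show n + 1 + (d + 1) + (n + 1) = (n + 1 + d + (n + 1)) + 1 by ring,
      show n + 1 + (d + 1) = n + 1 + d + 1 by ring, qFactorial_succ q d,
      qFactorial_succ q (n + 1 + d),
      qFactorial_succ q (n + 1 + d + (n + 1)),
      show n + 1 + (n + 1) + (d + 1) = n + 1 + d + (n + 1) + 1 by ring]
    have h2 := sub_ne_zero.2 (hq d).symm
    have h4 := sub_ne_zero.2 (hq (n + 1 + d + (n + 1))).symm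
    have := hF d
    have := hF (n + 1 + d + (n + 1))
    field_simp

/-- The ratio `x_m / (x_n - x_m)` for nodes `m = n + i + 1` above `n`. -/
theorem node_ratio_above (hq0 : q ≠ 0) (hq : ∀ j, q ^ (j + 1) ≠ 1) (n i : ℕ) :
    node q (n + 1 + (i + 1)) / (node q (n + 1) - node q (n + 1 + (i + 1))) =
      (1 - q ^ (n + 1)) / (1 + q ^ (n + 1)) * (q ^ (i + 1) / (1 - q ^ (i + 1)) -
        q ^ (n + 1 + (n + 1) + (i + 1)) / (1 - q ^ (n + 1 + (n + 1) + (i + 1)))) := by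
  have h1 := sub_ne_zero.2 (hq n).symm
  have h2 := sub_ne_zero.2 (hq i).symm
  have h3 := sub_ne_zero.2 (hq (n + 1 + i)).symm
  have h4 := sub_ne_zero.2 (hq (n + 1 + (n + 1) + i)).symm
  have h5 := one_add_pow_ne_zero hq n
  rw [add_assoc _ i 1, pow_add q (n + 1) (i + 1)] at h3
  rw [add_assoc _ i 1, pow_add q _ (i + 1), pow_add q (n + 1)] at h4
  rw [node, node, pow_add q _ (i + 1), pow_add q _ (i + 1), pow_add q (n + 1) (n + 1)]
  have hp : q ^ (n + 1) ≠ 0 := pow_ne_zero _ hq0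
  generalize q ^ (n + 1) = p at *
  generalize q ^ (i + 1) = y at *
  rw [← sq] at h4 ⊢
  have : p / (1 - p) ^ 2 - p * y / (1 - p * y) ^ 2 =
      p * (1 - y) * (1 - p ^ 2 * y) / ((1 - p) ^ 2 * (1 - p * y) ^ 2) := by
    field_simp; ring
  rw [this]
  field_simp
  ring

/-- The ratio `x_m / (x_n - x_m)` for nodes `n = m + i + 1` above `m`. -/
theorem node_ratio_below (hq0 : q ≠ 0) (hq : ∀ j, q ^ (j + 1) ≠ 1) (m i : ℕ) :
    node q (m + 1) / (node q (m + 1 + (i + 1)) - node q (m + 1)) =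
      -((1 - q ^ (m + 1 + (i + 1))) / (1 + q ^ (m + 1 + (i + 1))) * (q ^ (i + 1) / (1 - q ^ (i + 1))
        + 1 + q ^ (m + 1 + (m + 1) + (i + 1)) / (1 - q ^ (m + 1 + (m + 1) + (i + 1))))) := by
  have h1 := sub_ne_zero.2 (hq m).symm
  have h2 := sub_ne_zero.2 (hq i).symm
  have h3 := sub_ne_zero.2 (hq (m + 1 + i)).symm
  have h4 := sub_ne_zero.2 (hq (m + 1 + (m + 1) + i)).symm
  have h5 := one_add_pow_ne_zero hq (m + 1 + i)
  rw [add_assoc _ i 1, pow_add q (m + 1) (i + 1)] at h3 h5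
  rw [add_assoc _ i 1, pow_add q _ (i + 1), pow_add q (m + 1)] at h4
  rw [node, node, pow_add q _ (i + 1), pow_add q _ (i + 1), pow_add q (m + 1) (m + 1)]
  have hp : q ^ (m + 1) ≠ 0 := pow_ne_zero _ hq0
  generalize q ^ (m + 1) = p at *
  generalize q ^ (i + 1) = y at *
  rw [← sq] at h4 ⊢
  have : p * y / (1 - p * y) ^ 2 - p / (1 - p) ^ 2 =
      -(p * (1 - y) * (1 - p ^ 2 * y) / ((1 - p) ^ 2 * (1 - p * y) ^ 2)) := by
    field_simp; ring
  rw [this]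
  field_simp
  ring

/-- The sum of the ratios `x_m / (x_n - x_m)`, up to an elementary factor. -/
def ratioSum (q : K) (n N : ℕ) : K :=
  n + 2 - 1 / (1 - q ^ (n + 1)) - 1 / (1 - q ^ (n + 1 + (n + 1))) +
    ∑ j ∈ range (N + (n + 1)), q ^ (j + 1) / (1 - q ^ (j + 1)) -
    ∑ j ∈ range (N - (n + 1)), q ^ (j + 1) / (1 - q ^ (j + 1))

theorem sum_node_ratio (hq0 : q ≠ 0) (hq : ∀ j, q ^ (j + 1) ≠ 1) (n d : ℕ) :
    ∑ m ∈ (range (n + 1 + d)).erase n, node q (m + 1) / (node q (n + 1) - node q (m + 1)) =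
      -((1 - q ^ (n + 1)) / (1 + q ^ (n + 1)) * ratioSum q n (n + 1 + d)) := by
  induction d with
  | zero =>
    rw [add_zero, range_succ_erase_self]
    have hterm : ∀ m ∈ range n, node q (m + 1) / (node q (n + 1) - node q (m + 1)) =
        -((1 - q ^ (n + 1)) / (1 + q ^ (n + 1)) * (q ^ (n - 1 - m + 1) / (1 - q ^ (n - 1 - m + 1))
        + 1 + q ^ (n + 1 + m + 1) / (1 - q ^ (n + 1 + m + 1)))) := by
      intro m hm
      have h := node_ratio_below hq0 hq m (n - 1 - m)
      have hmn := mem_range.1 hm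
      rwa [show m + 1 + (n - 1 - m + 1) = n + 1 by omega,
        show m + 1 + (m + 1) + (n - 1 - m + 1) = n + 1 + m + 1 by omega] at h
    rw [sum_congr rfl hterm, sum_neg_distrib, ← mul_sum, sum_add_distrib, sum_add_distrib,
      sum_range_reflect (fun i => q ^ (i + 1) / (1 - q ^ (i + 1))), sum_const, card_range, ratioSum,
      Nat.sub_self, range_zero, sum_empty, ← add_assoc, sum_range_succ _ (n + 1 + n),
      sum_range_add _ (n + 1) n, sum_range_succ _ n]
    have h1 := sub_ne_zero.2 (hq n).symm
    have h2 := sub_ne_zero.2 (hq (n + 1 + n)).symm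
    have e1 : q ^ (n + 1) / (1 - q ^ (n + 1)) = 1 / (1 - q ^ (n + 1)) - 1 := by
      field_simp; ring
    have e2 : q ^ (n + 1 + n + 1) / (1 - q ^ (n + 1 + n + 1)) =
        1 / (1 - q ^ (n + 1 + n + 1)) - 1 := by
      field_simp; ring
    rw [e1, e2, nsmul_eq_mul]
    simp only [add_assoc]
    ring
  | succ d ih =>
    rw [← add_assoc, range_succ_erase (by omega), sum_insert (by simp), ih, add_assoc _ d 1,
      node_ratio_above hq0 hq n d, ratioSum, ratioSum,
      show n + 1 + (d + 1) + (n + 1) = (n + 1 + d + (n + 1)) + 1 by ring, sum_range_succ,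
      show n + 1 + (d + 1) - (n + 1) = d + 1 by omega, sum_range_succ,
      show n + 1 + d - (n + 1) = d by omega,
      show n + 1 + (n + 1) + (d + 1) = n + 1 + d + (n + 1) + 1 by ring]
    ring

theorem node_ratio_sq_above (hq0 : q ≠ 0) (hq : ∀ j, q ^ (j + 1) ≠ 1) (n i : ℕ) :
    (node q (n + 1 + (i + 1)) / (node q (n + 1) - node q (n + 1 + (i + 1)))) ^ 2 =
      ((1 - q ^ (n + 1)) / (1 + q ^ (n + 1))) ^ 2 *
        (node q (i + 1) + node q (n + 1 + (n + 1) + (i + 1))) -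
      (1 - q ^ (n + 1)) / (1 + q ^ (n + 1)) *
        ((1 + q ^ (n + 1 + (n + 1))) / (1 - q ^ (n + 1 + (n + 1)))) *
        (node q (n + 1 + (i + 1)) / (node q (n + 1) - node q (n + 1 + (i + 1)))) := by
  rw [node_ratio_above hq0 hq n i, node, node]
  have h1 := sub_ne_zero.2 (hq n).symm
  have h2 := sub_ne_zero.2 (hq i).symm
  have h4 := sub_ne_zero.2 (hq (n + 1 + (n + 1) + i)).symm
  have h5 := one_add_pow_ne_zero hq n
  rw [add_assoc _ i 1, pow_add q _ (i + 1), pow_add q (n + 1)] at h4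
  rw [pow_add q _ (i + 1), pow_add q (n + 1) (n + 1)]
  generalize q ^ (n + 1) = p at *
  generalize q ^ (i + 1) = y at *
  rw [← sq] at h4 ⊢
  have : 1 - p ^ 2 = (1 - p) * (1 + p) := by ring
  rw [this]
  field_simp
  ring

theorem node_ratio_sq_below (hq0 : q ≠ 0) (hq : ∀ j, q ^ (j + 1) ≠ 1) (m i : ℕ) :
    (node q (m + 1) / (node q (m + 1 + (i + 1)) - node q (m + 1))) ^ 2 =
      ((1 - q ^ (m + 1 + (i + 1))) / (1 + q ^ (m + 1 + (i + 1)))) ^ 2 *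
        (node q (i + 1) + node q (m + 1 + (m + 1) + (i + 1))) -
      (1 - q ^ (m + 1 + (i + 1))) / (1 + q ^ (m + 1 + (i + 1))) *
        ((1 + q ^ (m + 1 + (i + 1) + (m + 1 + (i + 1)))) /
          (1 - q ^ (m + 1 + (i + 1) + (m + 1 + (i + 1))))) *
        (node q (m + 1) / (node q (m + 1 + (i + 1)) - node q (m + 1))) := by
  rw [node_ratio_below hq0 hq m i, node, node]
  have h1 := sub_ne_zero.2 (hq m).symm
  have h2 := sub_ne_zero.2 (hq i).symm
  have h3 := sub_ne_zero.2 (hq (m + 1 + i)).symm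
  have h4 := sub_ne_zero.2 (hq (m + 1 + (m + 1) + i)).symm
  have h5 := one_add_pow_ne_zero hq (m + 1 + i)
  rw [add_assoc _ i 1, pow_add q (m + 1) (i + 1)] at h3 h5
  rw [add_assoc _ i 1, pow_add q _ (i + 1), pow_add q (m + 1)] at h4
  simp only [pow_add q _ (m + 1 + (i + 1)), pow_add q _ (i + 1), pow_add q (m + 1) (m + 1)]
  generalize q ^ (m + 1) = p at *
  generalize q ^ (i + 1) = y at *
  rw [← sq] at h4 ⊢
  have : 1 - p * y * (p * y) = (1 - p * y) * (1 + p * y) := by ring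
  rw [this]
  field_simp
  ring

/-- The sum of all nodes at distance `m - n` and `m + n` from `n`. -/
theorem sum_node_ratio_sq (hq0 : q ≠ 0) (hq : ∀ j, q ^ (j + 1) ≠ 1) (n d : ℕ) :
    ∑ m ∈ (range (n + 1 + d)).erase n, (node q (m + 1) / (node q (n + 1) - node q (m + 1))) ^ 2 =
      ((1 - q ^ (n + 1)) / (1 + q ^ (n + 1))) ^ 2 *
        (∑ j ∈ range d, node q (j + 1) + ∑ j ∈ range (n + 1 + d + (n + 1)), node q (j + 1)
          - node q (n + 1) - node q (n + 1 + (n + 1)) +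
        (1 + q ^ (n + 1 + (n + 1))) / (1 - q ^ (n + 1 + (n + 1))) *
          ratioSum q n (n + 1 + d)) := by
  suffices h : ∑ m ∈ (range (n + 1 + d)).erase n,
      (node q (m + 1) / (node q (n + 1) - node q (m + 1))) ^ 2 =
      ((1 - q ^ (n + 1)) / (1 + q ^ (n + 1))) ^ 2 *
        (∑ j ∈ range d, node q (j + 1) + ∑ j ∈ range (n + 1 + d + (n + 1)), node q (j + 1)
          - node q (n + 1) - node q (n + 1 + (n + 1))) -
      (1 - q ^ (n + 1)) / (1 + q ^ (n + 1)) *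
        ((1 + q ^ (n + 1 + (n + 1))) / (1 - q ^ (n + 1 + (n + 1)))) *
        ∑ m ∈ (range (n + 1 + d)).erase n, node q (m + 1) / (node q (n + 1) - node q (m + 1)) by
    rw [h, sum_node_ratio hq0 hq]; ring
  induction d with
  | zero =>
    rw [add_zero, range_succ_erase_self]
    have hterm : ∀ m ∈ range n, (node q (m + 1) / (node q (n + 1) - node q (m + 1))) ^ 2 =
        ((1 - q ^ (n + 1)) / (1 + q ^ (n + 1))) ^ 2 *
          (node q (n - 1 - m + 1) + node q (n + 1 + m + 1)) -
        (1 - q ^ (n + 1)) / (1 + q ^ (n + 1)) *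
        ((1 + q ^ (n + 1 + (n + 1))) / (1 - q ^ (n + 1 + (n + 1)))) *
        (node q (m + 1) / (node q (n + 1) - node q (m + 1))) := by
      intro m hm
      have h := node_ratio_sq_below hq0 hq m (n - 1 - m)
      have hmn := mem_range.1 hm
      rwa [show m + 1 + (n - 1 - m + 1) = n + 1 by omega,
        show m + 1 + (m + 1) + (n - 1 - m + 1) = n + 1 + m + 1 by omega] at h
    rw [sum_congr rfl hterm, sum_sub_distrib, ← mul_sum, ← mul_sum, sum_add_distrib,
      sum_range_reflect (fun i => node q (i + 1)),
      range_zero, sum_empty, ← add_assoc, sum_range_succ _ (n + 1 + n),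
      sum_range_add _ (n + 1) n, sum_range_succ _ n]
    ring
  | succ d ih =>
    rw [← add_assoc, range_succ_erase (by omega), sum_insert (by simp), sum_insert (by simp), ih,
      add_assoc _ d 1,
      node_ratio_sq_above hq0 hq n d,
      show n + 1 + (d + 1) + (n + 1) = (n + 1 + d + (n + 1)) + 1 by ring,
      sum_range_succ _ (n + 1 + d + (n + 1)), sum_range_succ _ d,
      show n + 1 + (n + 1) + (d + 1) = n + 1 + d + (n + 1) + 1 by ring]
    ring

end ClosedForms

section Limits

open PowerSeries

variable {F : Type*} [Field F]

/-- The Euler derivation `X d/dX` on power series. -/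
noncomputable def euler (F : Type*) [Field F] : Derivation F F⟦X⟧ F⟦X⟧ := (X : F⟦X⟧) • d⁄dX F

theorem coeff_euler (f : F⟦X⟧) (n : ℕ) : coeff n (euler F f) = n * coeff n f := by
  rw [euler, Derivation.smul_apply, smul_eq_mul]
  rcases n with _ | n
  · simp
  · rw [coeff_succ_X_mul, coeff_derivative]; push_cast; ring

theorem X_pow_dvd_euler {f : F⟦X⟧} {m : ℕ} (h : X ^ m ∣ f) : X ^ m ∣ euler F f := by
  rw [X_pow_dvd_iff] at h ⊢
  intro k hk
  rw [coeff_euler, h k hk, mul_zero]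

theorem euler_X_pow (m : ℕ) : euler F (X ^ m : F⟦X⟧) = m * (X ^ m : F⟦X⟧) := by
  ext k
  have h : (m : F⟦X⟧) = C (m : F) := (map_natCast C m).symm
  rw [coeff_euler, h, coeff_C_mul, coeff_X_pow]
  split_ifs with h <;> simp [h]

/-- `Tends f g` says that `f N` agrees with `g` up to and including degree `N`. -/
def Tends (f : ℕ → F⟦X⟧) (g : F⟦X⟧) : Prop := ∀ N, X ^ (N + 1) ∣ f N - g

namespace Tends

variable {f f' : ℕ → F⟦X⟧} {g g' : F⟦X⟧}

theorem const (g : F⟦X⟧) : Tends (fun _ => g) g := fun N => by simp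

theorem add (h : Tends f g) (h' : Tends f' g') : Tends (fun N => f N + f' N) (g + g') := fun N => by
  rw [add_sub_add_comm]; exact dvd_add (h N) (h' N)

theorem neg (h : Tends f g) : Tends (fun N => -f N) (-g) := fun N => by
  rw [← neg_sub', dvd_neg]; exact h N

theorem mul (h : Tends f g) (h' : Tends f' g') : Tends (fun N => f N * f' N) (g * g') := fun N => by
  rw [show f N * f' N - g * g' = (f N - g) * f' N + g * (f' N - g') by ring]
  exact dvd_add ((h N).mul_right _) ((h' N).mul_left _)

theorem const_mul (a : F⟦X⟧) (h : Tends f g) : Tends (fun N => a * f N) (a * g) := (const a).mul h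

theorem sum {ι : Type*} (s : Finset ι) {f : ι → ℕ → F⟦X⟧} {g : ι → F⟦X⟧}
    (h : ∀ i ∈ s, Tends (f i) (g i)) : Tends (fun N => ∑ i ∈ s, f i N) (∑ i ∈ s, g i) := fun N => by
  rw [← sum_sub_distrib]; exact dvd_sum fun i hi => h i hi N

theorem euler (h : Tends f g) :
    Tends (fun N => euler F (f N)) (SptModSeven.euler F g) := fun N => by
  rw [← map_sub]; exact X_pow_dvd_euler (h N)

theorem congr (h : Tends f g) (h' : ∀ N, X ^ (N + 1) ∣ f' N - f N) : Tends f' g := fun N => by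
  rw [← sub_add_sub_cancel]; exact dvd_add (h' N) (h N)

theorem unique (h : Tends f g) (h' : Tends f g') : g = g' := by
  ext k
  have := dvd_sub (h' k) (h k)
  rw [sub_sub_sub_cancel_left, X_pow_dvd_iff] at this
  simpa [sub_eq_zero] using this k k.lt_succ_self

theorem coeff_eq (h : Tends f g) {k N : ℕ} (hk : k ≤ N) : coeff k (f N) = coeff k g := by
  have := X_pow_dvd_iff.1 (h N) k (by omega)
  rwa [map_sub, sub_eq_zero] at this

theorem of_succ (h : ∀ N, X ^ (N + 1) ∣ f (N + 1) - f N) : ∃ g, Tends f g := by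
  have key : ∀ d N, X ^ (N + 1) ∣ f (N + d) - f N := by
    intro d N
    induction d with
    | zero => simp
    | succ d ih =>
      rw [← sub_add_sub_cancel]
      exact dvd_add ((pow_dvd_pow _ (by omega)).trans (h (N + d))) ih
  refine ⟨mk fun k => coeff k (f k), fun N => X_pow_dvd_iff.2 fun k hk => ?_⟩
  obtain ⟨d, rfl⟩ := Nat.exists_eq_add_of_le (Nat.lt_succ_iff.1 hk)
  have := X_pow_dvd_iff.1 (key d k) k k.lt_succ_self
  rwa [map_sub, coeff_mk, ← map_sub]

theorem of_sum {f : ℕ → F⟦X⟧} (h : ∀ n, X ^ (n + 1) ∣ f n) :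
    ∃ g, Tends (fun N => ∑ n ∈ range N, f n) g := by
  refine of_succ fun N => ?_
  rw [sum_range_succ, add_sub_cancel_left]
  exact h N

end Tends

end Limits

section Transfer

open PowerSeries

variable {F : Type*} [Field F]

theorem constantCoeff_qFactorial (n : ℕ) :
    constantCoeff (qFactorial X n : F⟦X⟧) = 1 := by simp [qFactorial]

/-- The power series `1 / (1 - X ^ (n + 1))`. -/
noncomputable def geom (F : Type*) [Field F] (n : ℕ) : F⟦X⟧ := (1 - X ^ (n + 1))⁻¹

/-- The power series `1 / (1 + X ^ (n + 1))`. -/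
noncomputable def altGeom (F : Type*) [Field F] (n : ℕ) : F⟦X⟧ := (1 + X ^ (n + 1))⁻¹

theorem geom_mul (n : ℕ) : geom F n * (1 - X ^ (n + 1)) = 1 :=
  PowerSeries.inv_mul_cancel _ (by simp)

theorem altGeom_mul (n : ℕ) : altGeom F n * (1 + X ^ (n + 1)) = 1 :=
  PowerSeries.inv_mul_cancel _ (by simp)

/-- The power series `X ^ (n + 1) / (1 - X ^ (n + 1)) ^ 2`. -/
noncomputable def nodeSeries (F : Type*) [Field F] (n : ℕ) : F⟦X⟧ := X ^ (n + 1) * geom F n ^ 2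

/-- The summand of the Appell-type series attached to the partial fraction expansion. -/
noncomputable def appellTerm (F : Type*) [Field F] (n : ℕ) : F⟦X⟧ :=
  (-1) ^ (n + 1) * X ^ (3 * (n * (n + 1) / 2) + 2 * (n + 1)) * (1 + X ^ (n + 1)) * geom F n ^ 2

theorem X_pow_dvd_nodeSeries (n : ℕ) : X ^ (n + 1) ∣ nodeSeries F n := Dvd.intro _ rfl

theorem X_pow_dvd_appellTerm (n : ℕ) : X ^ (n + 1) ∣ appellTerm F n := by
  rw [appellTerm, show 3 * (n * (n + 1) / 2) + 2 * (n + 1) =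
    (n + 1) + (3 * (n * (n + 1) / 2) + (n + 1)) by ring, pow_add]
  exact ⟨(-1) ^ (n + 1) * X ^ (3 * (n * (n + 1) / 2) + (n + 1)) * (1 + X ^ (n + 1)) * geom F n ^ 2,
    by ring⟩

theorem euler_geom (n : ℕ) :
    euler F (geom F n) = ((n + 1 : ℕ) : F⟦X⟧) * X ^ (n + 1) * geom F n * geom F n := by
  have h := congrArg (euler F) (geom_mul (F := F) n)
  rw [Derivation.leibniz, map_sub, euler_X_pow, Derivation.map_one_eq_zero, zero_sub, smul_eq_mul,
    smul_eq_mul] at h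
  linear_combination geom F n * h - euler F (geom F n) * geom_mul (F := F) n

theorem euler_nodeSeries (n : ℕ) : euler F (nodeSeries F n) =
    ((n + 1 : ℕ) : F⟦X⟧) * (1 + 2 * X ^ (n + 1) * geom F n) * nodeSeries F n := by
  rw [nodeSeries, Derivation.leibniz, Derivation.leibniz_pow, euler_X_pow, euler_geom]
  simp only [smul_eq_mul, nsmul_eq_mul]
  push_cast
  ring

theorem euler_appellTerm (n : ℕ) : euler F (appellTerm F n) =
    (((3 * (n * (n + 1) / 2) + 2 * (n + 1) : ℕ) : F⟦X⟧) +
    ((n + 1 : ℕ) : F⟦X⟧) * X ^ (n + 1) * altGeom F n +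
      2 * ((n + 1 : ℕ) : F⟦X⟧) * X ^ (n + 1) * geom F n) * appellTerm F n := by
  have h1 : euler F ((-1) ^ (n + 1)) = 0 := by
    rcases neg_one_pow_eq_or F⟦X⟧ (n + 1) with h | h <;> simp [h]
  have h2 := altGeom_mul (F := F) n
  rw [appellTerm]
  simp only [Derivation.leibniz, Derivation.leibniz_pow (euler F) (geom F n), euler_X_pow,
    euler_geom, h1, map_add, Derivation.map_one_eq_zero, smul_eq_mul, nsmul_eq_mul]
  linear_combination (-(-1) ^ (n + 1) * X ^ (3 * (n * (n + 1) / 2) + 2 * (n + 1)) *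
    ((n + 1 : ℕ) : F⟦X⟧) * X ^ (n + 1) * geom F n ^ 2) * h2

theorem euler_appellTerm_mul_pow (n j : ℕ) :
    euler F (appellTerm F n * nodeSeries F n ^ j) =
    (((3 * (n * (n + 1) / 2) + 2 * (n + 1) : ℕ) : F⟦X⟧) +
    ((n + 1 : ℕ) : F⟦X⟧) * X ^ (n + 1) * altGeom F n +
      2 * ((n + 1 : ℕ) : F⟦X⟧) * X ^ (n + 1) * geom F n +
      (j : F⟦X⟧) * ((n + 1 : ℕ) : F⟦X⟧) * (1 + 2 * X ^ (n + 1) * geom F n)) *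
      (appellTerm F n * nodeSeries F n ^ j) := by
  rw [Derivation.leibniz, Derivation.leibniz_pow, euler_appellTerm, euler_nodeSeries]
  simp only [smul_eq_mul, nsmul_eq_mul]
  rcases j with _ | j
  · simp
  · simp; ring

/-- The embedding of power series into their fraction field. -/
local notation "ι" => algebraMap F⟦X⟧ (FractionRing F⟦X⟧)

theorem algebraMap_inv {f : F⟦X⟧} (hf : constantCoeff f ≠ 0) : ι f⁻¹ = (ι f)⁻¹ := by
  refine eq_inv_of_mul_eq_one_left ?_
  rw [← map_mul, PowerSeries.inv_mul_cancel _ hf, map_one]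

theorem algebraMap_injective : Function.Injective ι := IsFractionRing.injective _ _

theorem algebraMap_geom (n : ℕ) : ι (geom F n) = (1 - ι X ^ (n + 1))⁻¹ := by
  rw [geom, algebraMap_inv (by simp)]; simp

theorem algebraMap_altGeom (n : ℕ) : ι (altGeom F n) = (1 + ι X ^ (n + 1))⁻¹ := by
  rw [altGeom, algebraMap_inv (by simp)]; simp

theorem algebraMap_nodeSeries (n : ℕ) : ι (nodeSeries F n) = node (ι X) (n + 1) := by
  rw [nodeSeries, map_mul, map_pow, map_pow, algebraMap_geom, node, inv_pow, div_eq_mul_inv]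

theorem algebraMap_X_ne_zero : ι X ≠ 0 := by
  rw [Ne, map_eq_zero_iff _ algebraMap_injective]
  exact X_ne_zero

theorem algebraMap_X_pow_ne_one (j : ℕ) : ι X ^ (j + 1) ≠ 1 := by
  intro h
  rw [← map_pow, ← map_one ι] at h
  have := congrArg constantCoeff (algebraMap_injective h)
  simp at this

end Transfer

section Coefficients

open PowerSeries

variable {F : Type*} [Field F]

/-- The `q`-binomial ratio `(q)_N ^ 2 / ((q)_{N-n-1} (q)_{N+n+1})` for `N = n + 1 + d`. -/
noncomputable def omegaSeries (F : Type*) [Field F] (n d : ℕ) : F⟦X⟧ :=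
  qFactorial X (n + 1 + d) ^ 2 *
    ((qFactorial X d)⁻¹ * (qFactorial X (n + 1 + d + (n + 1)))⁻¹)

/-- The power series version of `ratioSum` for `N = n + 1 + d`. -/
noncomputable def ratioSeries (F : Type*) [Field F] (n d : ℕ) : F⟦X⟧ :=
  n + 2 - geom F n - geom F (n + 1 + n) +
    ∑ j ∈ range (n + 1 + d + (n + 1)), X ^ (j + 1) * geom F j -
    ∑ j ∈ range d, X ^ (j + 1) * geom F j

/-- Twice the summand of the partial fraction expansion of the coefficients of the fourth power. -/
noncomputable def fourthTerm (F : Type*) [Field F] (k n : ℕ) (w t l : F⟦X⟧) : F⟦X⟧ :=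
  nodeSeries F n ^ k *
    ((-1) ^ n * X ^ (3 * (n * (n + 1) / 2)) * (1 + X ^ (n + 1)) ^ 3 * w ^ 3) *
    (((k : F⟦X⟧) + 2) * ((k : F⟦X⟧) + 1) +
    6 * ((k : F⟦X⟧) + 1) * ((1 - X ^ (n + 1)) * altGeom F n) * t +
      ((1 - X ^ (n + 1)) * altGeom F n) ^ 2 * (9 * t ^ 2 +
        3 * (l - nodeSeries F n - nodeSeries F (n + 1 + n) +
          (1 + X ^ (n + 1 + (n + 1))) * geom F (n + 1 + n) * t)))

local notation "ι" => algebraMap F⟦X⟧ (FractionRing F⟦X⟧)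

theorem algebraMap_omegaSeries (n d : ℕ) : ι (omegaSeries F n d) =
    qFactorial (ι X) (n + 1 + d) ^ 2 /
      (qFactorial (ι X) d * qFactorial (ι X) (n + 1 + d + (n + 1))) := by
  rw [omegaSeries, map_mul, map_mul, map_pow, algebraMap_inv (by simp [constantCoeff_qFactorial]),
    algebraMap_inv (by simp [constantCoeff_qFactorial])]
  simp only [map_qFactorial]
  rw [div_eq_mul_inv, mul_inv]

theorem algebraMap_ratioSeries (n d : ℕ) : ι (ratioSeries F n d) =
    ratioSum (ι X) n (n + 1 + d) := by
  rw [ratioSeries, ratioSum, show n + 1 + d - (n + 1) = d by omega,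
    show n + 1 + (n + 1) = n + 1 + n + 1 by ring]
  simp only [map_sub, map_add, map_sum, map_mul, map_pow, algebraMap_geom, map_natCast, map_ofNat,
    div_eq_mul_inv, one_mul]

theorem two_mul_coeff_prod_pow_four (h7 : CharP F 7) {k : ℕ} (hk : k < 7) (N : ℕ) (hN : N ≠ 0) :
    2 * coeff k ((∏ n ∈ range N, (1 - C (nodeSeries F n) * X)) ^ 4) =
      ∑ n ∈ range N, fourthTerm F k n (omegaSeries F n (N - (n + 1)))
        (ratioSeries F n (N - (n + 1)))
        (∑ j ∈ range (N - (n + 1)), nodeSeries F j +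
          ∑ j ∈ range (N + (n + 1)), nodeSeries F j) := by
  have h7' : CharP (FractionRing F⟦X⟧) 7 := by
    have : CharP F⟦X⟧ 7 := charP_of_injective_algebraMap (R := F) (C_injective) 7
    exact charP_of_injective_algebraMap (R := F⟦X⟧) algebraMap_injective 7
  have h2 : (2 : FractionRing F⟦X⟧) ≠ 0 := by
    have := CharP.cast_eq_zero_iff (FractionRing F⟦X⟧) 7 2
    norm_num at this; exact this
  have hq0 := algebraMap_X_ne_zero (F := F)
  have hq := algebraMap_X_pow_ne_one (F := F)
  apply algebraMap_injective
  have hmap := coeff_map ι k ((∏ n ∈ range N, (1 - C (nodeSeries F n) * X)) ^ 4)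
  simp only [map_pow, map_prod, map_sub, map_one, map_mul, map_C, map_X,
    algebraMap_nodeSeries] at hmap
  rw [map_mul, ← hmap, coeff_prod_pow_four h7' (fun n => node (ι X) (n + 1)) (by simpa using hN)
    (fun n _ => node_ne_zero hq0 hq n) (node_injOn hq0 hq).injOn hk, mul_sum, map_sum]
  refine sum_congr rfl fun n hn => ?_
  obtain ⟨d, rfl⟩ := Nat.exists_eq_add_of_le (Nat.succ_le_of_lt (mem_range.1 hn))
  rw [Nat.succ_eq_add_one, prod_erase_inv_one_sub_node hq0 hq, sum_node_ratio hq0 hq,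
    sum_node_ratio_sq hq0 hq,
    ← algebraMap_omegaSeries, ← algebraMap_ratioSeries, fourthTerm, Nat.add_sub_cancel_left]
  simp only [map_mul, map_pow, map_add, map_sub, map_one, map_ofNat, map_natCast, map_neg,
    algebraMap_nodeSeries, algebraMap_geom, algebraMap_altGeom, map_sum]
  have hs : ((-1 : FractionRing F⟦X⟧) ^ n) ^ 3 = (-1) ^ n := by
    rcases neg_one_pow_eq_or (FractionRing F⟦X⟧) n with h | h <;> rw [h] <;> norm_num
  rw [mul_pow, mul_pow, mul_pow, hs, ← pow_mul, mul_comm _ 3, add_assoc n 1 n, add_comm 1 n,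
    ← add_assoc n n 1]
  simp only [div_eq_mul_inv]
  rw [show n + 1 + (n + 1) = n + n + 1 + 1 by ring]
  field_simp
  ring

end Coefficients

section Asymptotics

open PowerSeries

variable {F : Type*} [Field F]

theorem X_pow_dvd_qFactorial_sub (d e : ℕ) :
    (X : F⟦X⟧) ^ (d + 1) ∣ qFactorial X (d + e) - qFactorial X d := by
  induction e with
  | zero => simp
  | succ e ih =>
    rw [← add_assoc, qFactorial_succ, show qFactorial (X : F⟦X⟧) (d + e) * (1 - X ^ (d + e + 1)) -
      qFactorial X d = qFactorial X (d + e) - qFactorial X d -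
        X ^ (d + 1) * (X ^ e * qFactorial X (d + e)) by ring]
    exact dvd_sub ih (Dvd.intro _ rfl)

theorem qFactorial_mul_inv (n : ℕ) : (qFactorial X n : F⟦X⟧) * (qFactorial X n)⁻¹ = 1 :=
  PowerSeries.mul_inv_cancel _ (by simp [constantCoeff_qFactorial])

theorem X_pow_dvd_omegaSeries_sub (n d : ℕ) : X ^ (d + 1) ∣ omegaSeries F n d - 1 := by
  have h1 := X_pow_dvd_qFactorial_sub (F := F) d (n + 1)
  have h2 := X_pow_dvd_qFactorial_sub (F := F) d (n + 1 + (n + 1))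
  rw [add_comm d (n + 1)] at h1
  rw [← add_assoc, add_comm d (n + 1)] at h2
  have e1 := qFactorial_mul_inv (F := F) d
  have e2 := qFactorial_mul_inv (F := F) (n + 1 + d + (n + 1))
  rw [omegaSeries]
  obtain ⟨a, ha⟩ := h1
  obtain ⟨b, hb⟩ := h2
  rw [sub_eq_iff_eq_add] at ha hb
  rw [ha]
  rw [hb] at e2 ⊢
  set P := (X ^ (d + 1) * b + qFactorial (X : F⟦X⟧) d)⁻¹
  set Q := (qFactorial (X : F⟦X⟧) d)⁻¹
  set D := qFactorial (X : F⟦X⟧) d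
  refine ⟨Q * P * (a * (X ^ (d + 1) * a + 2 * D) - b * D), ?_⟩
  linear_combination e2 + P * D * e1 + (X ^ (d + 1) * b * P) * e1

theorem X_pow_dvd_sum_sub {f : ℕ → F⟦X⟧} (hf : ∀ n, X ^ (n + 1) ∣ f n) (d e : ℕ) :
    X ^ (d + 1) ∣ ∑ j ∈ range (d + e), f j - ∑ j ∈ range d, f j := by
  rw [sum_range_add, add_sub_cancel_left]
  exact dvd_sum fun i _ => (pow_dvd_pow _ (by omega)).trans (hf (d + i))

/-- The limit of `ratioSeries F n d` as `d` grows. -/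
noncomputable def ratioLimit (F : Type*) [Field F] (n : ℕ) : F⟦X⟧ :=
  n + 2 - geom F n - geom F (n + 1 + n)

theorem X_pow_dvd_ratioSeries_sub (n d : ℕ) :
    X ^ (d + 1) ∣ ratioSeries F n d - ratioLimit F n := by
  have := X_pow_dvd_sum_sub (f := fun j => X ^ (j + 1) * geom F j) (fun n => Dvd.intro _ rfl)
    d (n + 1 + (n + 1))
  rw [ratioSeries, ratioLimit, show n + 1 + d + (n + 1) = d + (n + 1 + (n + 1)) by ring,
    add_sub_assoc, add_sub_cancel_left]
  exact this

theorem X_pow_dvd_fourthTerm_sub {k : ℕ} (hk : k ≠ 0) (n d : ℕ) {w w' t t' l l' : F⟦X⟧}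
    (hw : X ^ (d + 1) ∣ w - w') (ht : X ^ (d + 1) ∣ t - t') (hl : X ^ (d + 1) ∣ l - l') :
    X ^ (n + 1 + d + 1) ∣ fourthTerm F k n w t l - fourthTerm F k n w' t' l' := by
  rw [fourthTerm, fourthTerm, mul_assoc (nodeSeries F n ^ k), mul_assoc (nodeSeries F n ^ k),
    ← mul_sub, add_assoc (n + 1), pow_add]
  refine mul_dvd_mul ((X_pow_dvd_nodeSeries n).trans (dvd_pow_self _ hk)) ?_
  rw [← Ideal.mem_span_singleton, ← Ideal.Quotient.eq] at hw ht hl ⊢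
  simp only [map_mul, map_add, map_sub, map_pow, hw, ht, hl]

theorem tends_sum_fourthTerm (h7 : CharP F 7) {k : ℕ} (hk0 : k ≠ 0) (hk : k < 7) {L Φ : F⟦X⟧}
    (hL : Tends (fun N => ∑ n ∈ range N, nodeSeries F n) L)
    (hΦ : Tends (fun N => coeff k ((∏ n ∈ range N, (1 - C (nodeSeries F n) * X)) ^ 4)) Φ) :
    Tends (fun N => ∑ n ∈ range N, fourthTerm F k n 1 (ratioLimit F n) (2 * L)) (2 * Φ) := by
  refine (hΦ.const_mul 2).congr fun N => ?_
  rcases eq_or_ne N 0 with rfl | hN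
  · simp [coeff_one, hk0]
  rw [two_mul_coeff_prod_pow_four h7 hk N hN, ← sum_sub_distrib]
  refine dvd_sum fun n hn => ?_
  obtain ⟨d, rfl⟩ := Nat.exists_eq_add_of_le (Nat.succ_le_of_lt (mem_range.1 hn))
  rw [Nat.succ_eq_add_one, Nat.add_sub_cancel_left]
  rw [dvd_sub_comm]
  refine X_pow_dvd_fourthTerm_sub hk0 n d (X_pow_dvd_omegaSeries_sub n d)
    (X_pow_dvd_ratioSeries_sub n d) ?_
  rw [two_mul, add_sub_add_comm]
  refine dvd_add (hL d) ((pow_dvd_pow _ (by omega)).trans (hL (n + 1 + d + (n + 1))))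

theorem fourthTerm_eq (n j : ℕ) (L : F⟦X⟧) :
    fourthTerm F (j + 2) n 1 (ratioLimit F n) (2 * L) =
      -(2 * (2 * j + 3) * (j + 1) * (appellTerm F n * nodeSeries F n ^ (j + 1)) +
        (j + 1) * j * (appellTerm F n * nodeSeries F n ^ j) +
        6 * (euler F (appellTerm F n * nodeSeries F n ^ j) +
          L * (appellTerm F n * nodeSeries F n ^ j))) := by
  rw [euler_appellTerm_mul_pow, fourthTerm, ratioLimit, appellTerm]
  have hT : (2 : F⟦X⟧) * ((n * (n + 1) / 2 : ℕ) : F⟦X⟧) = n * (n + 1) := by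
    rw [← Nat.cast_ofNat (R := F⟦X⟧), ← Nat.cast_mul,
      Nat.mul_div_cancel' (Nat.even_mul_succ_self n).two_dvd]
    push_cast; ring
  have hg := geom_mul (F := F) n
  have ha := altGeom_mul (F := F) n
  have hg2 : geom F (n + 1 + n) = geom F n * altGeom F n := by
    have := geom_mul (F := F) (n + 1 + n)
    rw [show n + 1 + n + 1 = (n + 1) + (n + 1) by ring, pow_add] at this
    linear_combination (geom F n * altGeom F n) * this -
      (geom F (n + 1 + n)) * (1 + X ^ (n + 1)) * altGeom F n * hg
      - geom F (n + 1 + n) * ha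
  have hx : nodeSeries F (n + 1 + n) =
      X ^ (n + 1) * X ^ (n + 1) * (geom F n * altGeom F n) ^ 2 := by
    rw [nodeSeries, hg2, show n + 1 + n + 1 = (n + 1) + (n + 1) by ring, pow_add]
  rw [hx, hg2, pow_add _ j 2, pow_succ _ j, pow_add X (3 * _), pow_add X (n + 1),
    pow_mul' X 2 (n + 1)]
  have hx' : nodeSeries F n = X ^ (n + 1) * geom F n ^ 2 := rfl
  have hm : ((-1 : F⟦X⟧)) ^ (n + 1) = -(-1) ^ n := by ring
  rw [hm]
  push_cast
  generalize nodeSeries F n ^ j = y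
  rw [hx']
  generalize (-1 : F⟦X⟧) ^ n = s
  generalize (X : F⟦X⟧) ^ (3 * (n * (n + 1) / 2)) = z
  generalize ((n * (n + 1) / 2 : ℕ) : F⟦X⟧) = T at *
  generalize (X : F⟦X⟧) ^ (n + 1) = p at *
  apply algebraMap_injective
  have hg' := congrArg (algebraMap F⟦X⟧ (FractionRing F⟦X⟧)) hg
  have ha' := congrArg (algebraMap F⟦X⟧ (FractionRing F⟦X⟧)) ha
  have hT' := congrArg (algebraMap F⟦X⟧ (FractionRing F⟦X⟧)) hT
  simp only [map_mul, map_add, map_sub, map_pow, map_one, map_ofNat, map_natCast, map_neg] at *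
  generalize algebraMap F⟦X⟧ (FractionRing F⟦X⟧) s = s at *
  generalize algebraMap F⟦X⟧ (FractionRing F⟦X⟧) z = z at *
  generalize algebraMap F⟦X⟧ (FractionRing F⟦X⟧) T = T at *
  generalize algebraMap F⟦X⟧ (FractionRing F⟦X⟧) p = p at *
  generalize algebraMap F⟦X⟧ (FractionRing F⟦X⟧) y = y at *
  generalize algebraMap F⟦X⟧ (FractionRing F⟦X⟧) L = L at *
  have h1 : 1 - p ≠ 0 := right_ne_zero_of_mul_eq_one hg'
  have h3 : 1 + p ≠ 0 := right_ne_zero_of_mul_eq_one ha'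
  rw [eq_one_div_of_mul_eq_one_left hg', eq_one_div_of_mul_eq_one_left ha']
  field_simp
  linear_combination (-9 * (1 + p) ^ 2 * (1 - p) ^ 2 * y * p ^ 2 * s * z) * hT'

/-- The partial fraction expansion gives linear relations between the coefficients of the fourth
power of the limiting product and the moments of the Appell-type series. -/
theorem two_mul_eq_moments (h7 : CharP F 7) {j : ℕ} (hj : j < 5) {L Φ : F⟦X⟧} {r : ℕ → F⟦X⟧}
    (hL : Tends (fun N => ∑ n ∈ range N, nodeSeries F n) L)
    (hr : ∀ j, Tends (fun N => ∑ n ∈ range N, appellTerm F n * nodeSeries F n ^ j) (r j))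
    (hΦ : Tends (fun N => coeff (j + 2) ((∏ n ∈ range N, (1 - C (nodeSeries F n) * X)) ^ 4)) Φ) :
    2 * Φ = -(2 * (2 * j + 3) * (j + 1) * r (j + 1) + (j + 1) * j * r j +
      6 * (euler F (r j) + L * r j)) := by
  refine (tends_sum_fourthTerm h7 (by omega) (by omega) hL hΦ).unique ?_
  have := ((((hr (j + 1)).const_mul (2 * (2 * (j : F⟦X⟧) + 3) * ((j : F⟦X⟧) + 1))).add
    ((hr j).const_mul (((j : F⟦X⟧) + 1) * (j : F⟦X⟧)))).add
      (((hr j).euler.add ((hr j).const_mul L)).const_mul 6)).neg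
  refine this.congr fun N => ?_
  rw [sub_eq_zero.2]
  · exact dvd_zero _
  simp only [mul_sum, map_sum, ← sum_add_distrib, ← sum_neg_distrib]
  exact sum_congr rfl fun n _ => fourthTerm_eq n j L

end Asymptotics

section BaileyPair

variable {K : Type*} [Field K] {q : K}

/-- The quantity `(-1) ^ r * q ^ (r * (3 * r - 1) / 2) * (1 + q ^ r)`, normalised to `1` at `0`. -/
def baileyAlpha (q : K) : ℕ → K
  | 0 => 1
  | r + 1 => (-1) ^ (r + 1) * q ^ (3 * (r * (r + 1) / 2) + (r + 1)) * (1 + q ^ (r + 1))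

/-- The kernel `1 / ((q)_{n-r} (q)_{n+r})`. -/
def baileyKernel (q : K) (n r : ℕ) : K := 1 / (qFactorial q (n - r) * qFactorial q (n + r))

theorem triangle_succ_div (n : ℕ) :
    (n + 1) * (n + 1 + 1) / 2 = n * (n + 1) / 2 + (n + 1) := by
  have := Nat.triangle_succ (n + 1)
  simpa [mul_comm] using this

theorem sum_baileyAlpha_partial (hq : ∀ j, q ^ (j + 1) ≠ 1) (n R : ℕ) (hR : R ≤ n) :
    ∑ r ∈ range (R + 1), baileyAlpha q r *
      ((1 - q ^ n) - (1 - q ^ (n - r)) * (1 - q ^ (n + r))) * baileyKernel q n r =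
    (-1) ^ R * (q ^ n * q ^ (3 * (R * (R + 1) / 2)) * (1 - q ^ (n - R)) * baileyKernel q n R) := by
  induction R with
  | zero =>
    simp only [zero_add, sum_range_one, baileyAlpha, Nat.sub_zero, add_zero]
    ring
  | succ R ih =>
    obtain ⟨d, rfl⟩ := Nat.exists_eq_add_of_le hR
    rw [sum_range_succ, ih (by omega), baileyKernel, baileyKernel, baileyAlpha, triangle_succ_div,
      show R + 1 + d - R = d + 1 by omega, Nat.add_sub_cancel_left,
      show R + 1 + d + (R + 1) = R + 1 + d + R + 1 by ring, qFactorial_succ q d,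
      qFactorial_succ q (R + 1 + d + R)]
    have h1 := qFactorial_ne_zero hq d
    have h2 := qFactorial_ne_zero hq (R + 1 + d + R)
    have h3 := sub_ne_zero.2 (hq d).symm
    have h4 := sub_ne_zero.2 (hq (R + 1 + d + R)).symm
    field_simp
    ring

theorem sum_baileyAlpha (hq : ∀ j, q ^ (j + 1) ≠ 1) (n : ℕ) :
    ∑ r ∈ range (n + 1), baileyAlpha q r * baileyKernel q n r = 1 / qFactorial q n := by
  induction n with
  | zero => simp [baileyAlpha, baileyKernel, qFactorial_zero]
  | succ n ih =>
    have h := sum_baileyAlpha_partial hq (n + 1) (n + 1) le_rfl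
    rw [Nat.sub_self, pow_zero, sub_self, mul_zero, zero_mul, mul_zero] at h
    have hlow : ∑ r ∈ range (n + 1 + 1), baileyAlpha q r *
        ((1 - q ^ (n + 1 - r)) * (1 - q ^ (n + 1 + r))) * baileyKernel q (n + 1) r =
        1 / qFactorial q n := by
      rw [sum_range_succ, Nat.sub_self, pow_zero, sub_self, zero_mul, mul_zero, zero_mul, add_zero,
        ← ih]
      refine sum_congr rfl fun r hr => ?_
      obtain ⟨d, rfl⟩ := Nat.exists_eq_add_of_le (Nat.lt_succ_iff.1 (mem_range.1 hr))
      rw [baileyKernel, baileyKernel, show r + d + 1 - r = d + 1 by omega, Nat.add_sub_cancel_left,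
        show r + d + 1 + r = r + d + r + 1 by ring, qFactorial_succ, qFactorial_succ]
      have h3 := sub_ne_zero.2 (hq d).symm
      have h4 := sub_ne_zero.2 (hq (r + d + r)).symm
      field_simp
    have h5 := sub_ne_zero.2 (hq n).symm
    have h6 := qFactorial_ne_zero hq n
    have hsum : (1 - q ^ (n + 1)) * ∑ r ∈ range (n + 1 + 1), baileyAlpha q r *
        baileyKernel q (n + 1) r = 1 / qFactorial q n := by
      rw [← hlow, ← sub_eq_zero, mul_sum, ← sum_sub_distrib, ← h]
      exact sum_congr rfl fun r _ => by ring
    rw [qFactorial_succ, mul_comm (qFactorial q n), ← div_div, eq_div_iff h6, eq_div_iff h5,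
      mul_right_comm, mul_comm _ (1 - q ^ (n + 1)), hsum, one_div_mul_cancel h6]

theorem sum_qFactorial_eq (hq0 : q ≠ 0) (hq : ∀ j, q ^ (j + 1) ≠ 1) (N : ℕ) :
    ∑ n ∈ range N, q ^ (n + 1) * qFactorial q n / (1 - q ^ (n + 1)) =
      ∑ n ∈ range N, node q (n + 1) + ∑ n ∈ range N, baileyAlpha q (n + 1) * node q (n + 1) *
        (qFactorial q N ^ 2 * baileyKernel q N (n + 1)) := by
  induction N with
  | zero => simp
  | succ N ih =>
    have hN := sub_ne_zero.2 (hq N).symm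
    have hFN := qFactorial_ne_zero hq N
    have hstep : q ^ (N + 1) * qFactorial q N / (1 - q ^ (N + 1)) =
        q ^ (N + 1) * qFactorial q N ^ 2 * (1 / qFactorial q (N + 1)) := by
      rw [qFactorial_succ]; field_simp
    have h0 : q ^ (N + 1) * qFactorial q N ^ 2 * (baileyAlpha q 0 * baileyKernel q (N + 1) 0) =
        node q (N + 1) := by
      rw [baileyAlpha, baileyKernel, node, Nat.sub_zero, add_zero, qFactorial_succ]; field_simp
    have hp : ∀ n ∈ range N, q ^ (N + 1) * qFactorial q N ^ 2 *
        (baileyAlpha q (n + 1) * baileyKernel q (N + 1) (n + 1)) +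
        baileyAlpha q (n + 1) * node q (n + 1) * (qFactorial q N ^ 2 * baileyKernel q N (n + 1)) =
        baileyAlpha q (n + 1) * node q (n + 1) *
          (qFactorial q (N + 1) ^ 2 * baileyKernel q (N + 1) (n + 1)) := by
      intro n hn
      obtain ⟨d, rfl⟩ := Nat.exists_eq_add_of_le (Nat.succ_le_of_lt (mem_range.1 hn))
      rw [Nat.succ_eq_add_one, baileyKernel, baileyKernel, node,
        show n + 1 + d + 1 - (n + 1) = d + 1 by omega, Nat.add_sub_cancel_left,
        show n + 1 + d + 1 + (n + 1) = n + 1 + d + (n + 1) + 1 by ring, qFactorial_succ q d,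
        qFactorial_succ q (n + 1 + d + (n + 1)), qFactorial_succ q (n + 1 + d)]
      have h1 := qFactorial_ne_zero hq d
      have h2 := qFactorial_ne_zero hq (n + 1 + d + (n + 1))
      have h3 := sub_ne_zero.2 (hq d).symm
      have h4 := sub_ne_zero.2 (hq (n + 1 + d + (n + 1))).symm
      have h5 := sub_ne_zero.2 (hq n).symm
      field_simp
      ring
    have hlast : q ^ (N + 1) * qFactorial q N ^ 2 *
        (baileyAlpha q (N + 1) * baileyKernel q (N + 1) (N + 1)) =
        baileyAlpha q (N + 1) * node q (N + 1) *
          (qFactorial q (N + 1) ^ 2 * baileyKernel q (N + 1) (N + 1)) := by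
      rw [node, qFactorial_succ]; field_simp
    rw [sum_range_succ, ih, hstep, ← sum_baileyAlpha hq, sum_range_succ', sum_range_succ,
      sum_range_succ _ N, sum_range_succ _ N, ← sum_congr rfl hp, sum_add_distrib, ← hlast, ← h0,
      ← mul_sum]
    ring

end BaileyPair

section Series

open PowerSeries

variable {F : Type*} [Field F]

theorem sum_qFactorial_geom (N : ℕ) :
    ∑ n ∈ range N, X ^ (n + 1) * qFactorial X n * geom F n =
      ∑ n ∈ range N, nodeSeries F n +
        ∑ n ∈ range N, appellTerm F n * omegaSeries F n (N - (n + 1)) := by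
  apply algebraMap_injective
  have h := sum_qFactorial_eq (algebraMap_X_ne_zero (F := F)) algebraMap_X_pow_ne_one N
  simp only [map_add, map_sum, map_mul, map_pow, algebraMap_geom, map_qFactorial,
    algebraMap_nodeSeries, ← div_eq_mul_inv]
  rw [h]
  congr 1
  refine sum_congr rfl fun n hn => ?_
  obtain ⟨d, rfl⟩ := Nat.exists_eq_add_of_le (Nat.succ_le_of_lt (mem_range.1 hn))
  rw [Nat.succ_eq_add_one, Nat.add_sub_cancel_left, algebraMap_omegaSeries, baileyAlpha,
    baileyKernel, node, appellTerm, Nat.add_sub_cancel_left]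
  simp only [map_mul, map_pow, map_add, map_neg, map_one, algebraMap_geom]
  have h5 := sub_ne_zero.2 (algebraMap_X_pow_ne_one (F := F) n).symm
  field_simp
  ring

theorem tends_sum_qFactorial_geom {L r : F⟦X⟧}
    (hL : Tends (fun N => ∑ n ∈ range N, nodeSeries F n) L)
    (hr : Tends (fun N => ∑ n ∈ range N, appellTerm F n) r) :
    Tends (fun N => ∑ n ∈ range N, X ^ (n + 1) * qFactorial X n * geom F n) (L + r) := by
  refine (hL.add hr).congr fun N => ?_
  rw [sum_qFactorial_geom, add_sub_add_left_eq_sub, ← sum_sub_distrib]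
  refine dvd_sum fun n hn => ?_
  obtain ⟨d, rfl⟩ := Nat.exists_eq_add_of_le (Nat.succ_le_of_lt (mem_range.1 hn))
  rw [Nat.succ_eq_add_one, Nat.add_sub_cancel_left, ← mul_sub_one, add_assoc (n + 1), pow_add]
  exact mul_dvd_mul (X_pow_dvd_appellTerm n) (X_pow_dvd_omegaSeries_sub n d)

end Series

section SmallestParts

open PowerSeries PowerSeries.WithPiTopology

variable {F : Type*} [Field F]

/-- Weight selecting the partitions all of whose parts exceed `n + 1`. -/
def aboveWeight (F : Type*) [Field F] (n i _c : ℕ) : F := if n + 1 < i then 1 else 0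

/-- Weight of the partitions without parts below `n + 1` that counts the parts `n + 1`, if any. -/
def countWeight (F : Type*) [Field F] (n i c : ℕ) : F :=
  if n + 1 < i then 1 else if i = n + 1 then (c : F) else 0

theorem prod_countWeight_sub_prod_aboveWeight (n : ℕ) (s : Multiset ℕ) :
    s.toFinsupp.prod (countWeight F n) - s.toFinsupp.prod (aboveWeight F n) =
      ((s.filter (fun j => ∀ i ∈ s, j ≤ i)).count (n + 1) : F) := by
  simp only [Finsupp.prod, Multiset.toFinsupp_support, Multiset.toFinsupp_apply]
  rw [Multiset.count_filter]
  split_ifs with h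
  · by_cases hn : n + 1 ∈ s
    · rw [prod_eq_zero (f := fun i => aboveWeight F n i (s.count i)) (Multiset.mem_toFinset.2 hn)
        (by simp [aboveWeight]), prod_eq_single_of_mem (n + 1) (Multiset.mem_toFinset.2 hn)]
      · simp [countWeight]
      · intro i hi hne
        have := h i (Multiset.mem_toFinset.1 hi)
        simp [countWeight, show n + 1 < i by omega]
    · rw [Multiset.count_eq_zero_of_notMem hn, Nat.cast_zero, sub_eq_zero]
      refine prod_congr rfl fun i hi => ?_
      have hne : i ≠ n + 1 := by rintro rfl; exact hn (Multiset.mem_toFinset.1 hi)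
      simp [countWeight, aboveWeight, hne]
  · push Not at h
    obtain ⟨i, hi, hlt⟩ := h
    rw [prod_eq_zero (Multiset.mem_toFinset.2 hi), prod_eq_zero (Multiset.mem_toFinset.2 hi),
      sub_zero, Nat.cast_zero]
    · simp [aboveWeight, hlt.le]
    · simp [countWeight, hlt.le, hlt.ne]

theorem coeff_sum_genFun_sub {m M : ℕ} (h : m ≤ M) :
    coeff m (∑ n ∈ range M, (Nat.Partition.genFun (countWeight F n) -
      Nat.Partition.genFun (aboveWeight F n))) = (spt m : F) := by
  simp only [map_sum, map_sub, Nat.Partition.coeff_genFun, ← sum_sub_distrib,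
    prod_countWeight_sub_prod_aboveWeight]
  rw [sum_comm, spt, Nat.cast_sum]
  refine sum_congr rfl fun p _ => ?_
  rw [← Nat.cast_sum]
  congr 1
  rw [← Multiset.sum_count_eq_card (s := (range M).map (addRightEmbedding 1)), sum_map]
  · rfl
  · intro a ha
    have hp := Multiset.mem_of_mem_filter ha
    have h1 := p.parts_pos hp
    have h2 := p.le_of_mem_parts hp
    rw [mem_map]
    exact ⟨a - 1, mem_range.2 (by omega), Nat.sub_add_cancel h1⟩

theorem tsum_pow_mul_one_sub [TopologicalSpace F] [DiscreteTopology F] (i : ℕ) :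
    (∑' j : ℕ, (1 : F) • (X : F⟦X⟧) ^ ((i + 1) * (j + 1))) * (1 - X ^ (i + 1)) = X ^ (i + 1) := by
  have hs := Nat.Partition.summable_genFun_term (fun _ _ => (1 : F)) i
  rw [mul_one_sub, sub_eq_iff_eq_add, ← hs.tsum_mul_right, hs.tsum_eq_zero_add]
  simp only [one_smul, ← pow_add, zero_add, mul_one]
  rfl

theorem tsum_nat_mul_pow [TopologicalSpace F] [DiscreteTopology F] (i : ℕ) :
    (∑' j : ℕ, ((j + 1 : ℕ) : F) • (X : F⟦X⟧) ^ ((i + 1) * (j + 1))) = nodeSeries F i := by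
  have h1 := Nat.Partition.summable_genFun_term (fun _ _ => (1 : F)) i
  have h2 := Nat.Partition.summable_genFun_term (fun _ c => (c : F)) i
  have hkey : (∑' j : ℕ, ((j + 1 : ℕ) : F) • (X : F⟦X⟧) ^ ((i + 1) * (j + 1))) *
      (1 - X ^ (i + 1)) ^ 2 = X ^ (i + 1) := by
    refine Eq.trans ?_ (tsum_pow_mul_one_sub i)
    rw [pow_two, ← mul_assoc]
    congr 1
    rw [mul_one_sub, sub_eq_iff_eq_add, ← h2.tsum_mul_right, h1.tsum_eq_zero_add, add_assoc,
      ← ((summable_nat_add_iff 1).2 h1).tsum_add (h2.mul_right _), h2.tsum_eq_zero_add]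
    congr 1
    · simp
    · refine tsum_congr fun j => ?_
      simp only [smul_eq_C_mul, one_mul, map_one, map_natCast]
      push_cast
      ring
  rw [nodeSeries, ← hkey, mul_assoc, ← mul_pow, mul_comm _ (geom F i), geom_mul, one_pow, mul_one]

theorem pentagonalSeries_mul_genFun {f : ℕ → ℕ → F} {n : ℕ} {a : F⟦X⟧}
    (h0 : ∀ i < n, ∀ c, f (i + 1) c = 0)
    (h1 : ∀ [TopologicalSpace F] [DiscreteTopology F],
      1 + ∑' j : ℕ, f (n + 1) (j + 1) • (X : F⟦X⟧) ^ ((n + 1) * (j + 1)) = a)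
    (h2 : ∀ i, n < i → ∀ c, f (i + 1) c = 1) :
    pentagonalSeries F * Nat.Partition.genFun f = qFactorial X (n + 1) * a := by
  let _ : TopologicalSpace F := ⊥
  have _ : DiscreteTopology F := ⟨rfl⟩
  refine ((hasProd_one_sub_X_pow F).mul (Nat.Partition.hasProd_genFun f)).unique ?_
  have hfin : qFactorial X (n + 1) * a = ∏ i ∈ range (n + 1), ((1 - X ^ (i + 1)) *
      (1 + ∑' j : ℕ, f (i + 1) (j + 1) • (X : F⟦X⟧) ^ ((i + 1) * (j + 1)))) := by
    rw [prod_mul_distrib, prod_range_succ _ n, prod_range_succ _ n, h1, prod_eq_one (s := range n)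
      (f := fun i => 1 + ∑' j : ℕ, f (i + 1) (j + 1) • (X : F⟦X⟧) ^ ((i + 1) * (j + 1))), one_mul,
      qFactorial, prod_range_succ]
    intro i hi
    simp [h0 i (mem_range.1 hi)]
  rw [hfin]
  refine hasProd_prod_of_ne_finset_one fun i hi => ?_
  have hi' : n < i := by simpa using hi
  simp only [h2 i hi']
  rw [mul_comm, add_mul, tsum_pow_mul_one_sub]
  ring

theorem pentagonalSeries_mul_sub (n : ℕ) :
    pentagonalSeries F * (Nat.Partition.genFun (countWeight F n) -
      Nat.Partition.genFun (aboveWeight F n)) = X ^ (n + 1) * qFactorial X n * geom F n := by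
  rw [mul_sub, pentagonalSeries_mul_genFun (n := n) (a := 1 + nodeSeries F n),
    pentagonalSeries_mul_genFun (n := n) (a := 1), qFactorial_succ, nodeSeries]
  · linear_combination X ^ (n + 1) * qFactorial X n * geom F n * geom_mul (F := F) n
  · intro i hi c; simp [aboveWeight, hi.le]
  · simp [aboveWeight]
  · intro i hi c; simp [aboveWeight, hi]
  · intro i hi c; simp [countWeight, hi.le, hi.ne]
  · intros; simp [countWeight, ← tsum_nat_mul_pow]
  · intro i hi c; simp [countWeight, hi]

theorem pentagonalSeries_mul_mk_spt {g : F⟦X⟧}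
    (h : Tends (fun N => ∑ n ∈ range N, X ^ (n + 1) * qFactorial X n * geom F n) g) :
    pentagonalSeries F * mk (fun m => (spt m : F)) = g := by
  have hS : Tends (fun M => ∑ n ∈ range M, (Nat.Partition.genFun (countWeight F n) -
      Nat.Partition.genFun (aboveWeight F n))) (mk fun m => (spt m : F)) := fun M => by
    rw [X_pow_dvd_iff]
    intro m hm
    rw [map_sub, coeff_sum_genFun_sub (Nat.lt_succ_iff.1 hm), coeff_mk, sub_self]
  refine (hS.const_mul (pentagonalSeries F)).unique ?_
  simpa only [mul_sum, pentagonalSeries_mul_sub] using h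

end SmallestParts

section JacobiPolynomial

open Polynomial

variable {K : Type*} [Field K] {q : K}

/-- The polynomials with `U (z + z⁻¹ - 2) = (z ^ (m + 1) - z ^ (-m)) / (z - 1)`. -/
noncomputable def jacobiPoly (K : Type*) [Field K] : ℕ → K[X]
  | 0 => 1
  | 1 => X + 3
  | m + 2 => (X + 2) * jacobiPoly K (m + 1) - jacobiPoly K m

/-- The coefficients of `jacobiPoly`. -/
def jacobiNumber (k m : ℕ) : ℕ := (m + k + 1).choose (2 * k + 1) + (m + k).choose (2 * k + 1)

theorem coeff_jacobiPoly (m k : ℕ) : (jacobiPoly K m).coeff k = (jacobiNumber k m : K) := by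
  induction m using Nat.twoStepInduction generalizing k with
  | zero =>
    rcases k with _ | k
    · simp [jacobiPoly, jacobiNumber]
    · rw [jacobiPoly, coeff_one, if_neg (by omega), jacobiNumber,
        Nat.choose_eq_zero_of_lt (by omega), Nat.choose_eq_zero_of_lt (by omega)]
      simp
  | one =>
    rw [jacobiPoly, show (3 : K[X]) = C 3 from rfl, coeff_add, coeff_X, coeff_C]
    rcases k with _ | _ | k
    · norm_num [jacobiNumber]
    · norm_num [jacobiNumber]
    · rw [if_neg (by omega), if_neg (by omega), jacobiNumber,
        Nat.choose_eq_zero_of_lt (by omega), Nat.choose_eq_zero_of_lt (by omega)]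
      simp
  | more m ih1 ih2 =>
    rw [jacobiPoly, show (2 : K[X]) = C 2 from rfl, add_mul, coeff_sub, coeff_add, coeff_C_mul, ih1,
      ih2]
    rcases k with _ | k
    · rw [mul_coeff_zero, coeff_X_zero, jacobiNumber, jacobiNumber, jacobiNumber]
      simp
      ring
    · rw [coeff_X_mul, ih2, jacobiNumber, jacobiNumber, jacobiNumber, jacobiNumber,
        show m + 2 + (k + 1) + 1 = m + k + 1 + 1 + 1 + 1 by ring,
        show m + 2 + (k + 1) = m + k + 1 + 1 + 1 by ring,
        show m + 1 + k + 1 = m + k + 1 + 1 by ring,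
        show m + 1 + k = m + k + 1 by ring,
        show m + 1 + (k + 1) + 1 = m + k + 1 + 1 + 1 by ring,
        show m + 1 + (k + 1) = m + k + 1 + 1 by ring,
        show m + (k + 1) + 1 = m + k + 1 + 1 by ring,
        show m + (k + 1) = m + k + 1 by ring,
        show 2 * (k + 1) + 1 = 2 * k + 1 + 1 + 1 by ring]
      simp only [Nat.choose_succ_succ (m + k + 1 + 1 + 1), Nat.choose_succ_succ (m + k + 1 + 1),
        Nat.choose_succ_succ (m + k + 1), Nat.succ_eq_add_one]
      push_cast
      ring

theorem choose_succ_mul (n k : ℕ) :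
    (n.choose (k + 1) : ℤ) * (k + 1) = n.choose k * (n - k) := by
  rcases le_or_gt k n with h | h
  · have := Nat.choose_succ_right_eq n k
    rw [← Nat.cast_sub h]
    exact_mod_cast this
  · rw [Nat.choose_eq_zero_of_lt h, Nat.choose_eq_zero_of_lt (by omega)]
    simp

theorem jacobiNumber_heat (k m : ℕ) :
    (m : ℤ) * (m + 1) * jacobiNumber k m =
      (2 * k + 3) * (2 * k + 2) * jacobiNumber (k + 1) m + k * (k + 1) * jacobiNumber k m := by
  have h1 := choose_succ_mul (m + k) (2 * k)
  have h2 := choose_succ_mul (m + k) (2 * k + 1)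
  have h3 := choose_succ_mul (m + k) (2 * k + 2)
  rw [jacobiNumber, jacobiNumber, show m + (k + 1) + 1 = m + k + 1 + 1 by ring,
    show m + (k + 1) = m + k + 1 by ring, show 2 * (k + 1) + 1 = 2 * k + 1 + 1 + 1 by ring]
  simp only [Nat.choose_succ_succ (m + k + 1), Nat.choose_succ_succ (m + k), Nat.succ_eq_add_one]
  push_cast at h1 h2 h3 ⊢
  linear_combination (-(m : ℤ) - k - 1) * h1 - (6 * k + 9 + 2 * (m - k - 2)) * h2
    - 2 * (2 * k + 2) * h3

theorem X_add_two_mul_sum_jacobiPoly {c : ℕ → K} {N : ℕ} (hc : ∀ m, N < m → c m = 0) :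
    (X + 2) * ∑ m ∈ range (N + 1), C (c m) * jacobiPoly K m =
      C (c 1 - c 0) * jacobiPoly K 0 +
        ∑ m ∈ range (N + 1), C (c m + c (m + 2)) * jacobiPoly K (m + 1) := by
  have h1 : ∑ m ∈ range (N + 1), C (c (m + 2)) * jacobiPoly K (m + 1) =
      ∑ m ∈ range N, C (c (m + 1)) * jacobiPoly K m - C (c 1) * jacobiPoly K 0 := by
    have h := sum_range_succ' (fun m => C (c (m + 1)) * jacobiPoly K m) (N + 1)
    rw [sum_range_succ, sum_range_succ, hc (N + 1) (by omega), hc (N + 1 + 1) (by omega)] at h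
    simp only [map_zero, zero_mul, add_zero, zero_add] at h
    rw [h, add_sub_cancel_right]
  have h2 : ∀ m ∈ range N, (X + 2) * (C (c (m + 1)) * jacobiPoly K (m + 1)) =
      C (c (m + 1)) * jacobiPoly K (m + 1 + 1) + C (c (m + 1)) * jacobiPoly K m := by
    intro m _
    rw [jacobiPoly]
    ring
  simp only [map_add, add_mul, sum_add_distrib]
  rw [h1, ← add_mul, mul_sum, sum_range_succ', sum_congr rfl h2, sum_add_distrib, sum_range_succ',
    jacobiPoly, jacobiPoly, map_sub]
  ring

/-- The coefficients of the finite triple product in terms of `jacobiPoly`. -/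
def jacobiCoeff (q : K) (N m : ℕ) : K :=
  if m ≤ N then (-1) ^ m * q ^ (m * (m + 1) / 2) *
    (qFactorial q (2 * N + 1) / (qFactorial q (N - m) * qFactorial q (N + m + 1))) else 0

theorem jacobiCoeff_of_lt {N m : ℕ} (h : N < m) : jacobiCoeff q N m = 0 := if_neg (by omega)

theorem jacobiCoeff_add (m d : ℕ) : jacobiCoeff q (m + d) m = (-1) ^ m * q ^ (m * (m + 1) / 2) *
    (qFactorial q (2 * (m + d) + 1) / (qFactorial q d * qFactorial q (m + d + m + 1))) := by
  rw [jacobiCoeff, if_pos (by omega), Nat.add_sub_cancel_left]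

theorem jacobiCoeff_succ_succ (hq : ∀ j, q ^ (j + 1) ≠ 1) (N m : ℕ) :
    jacobiCoeff q (N + 1) (m + 1) = (1 + (q ^ (N + 1)) ^ 2) * jacobiCoeff q N (m + 1) -
      q ^ (N + 1) * (jacobiCoeff q N m + jacobiCoeff q N (m + 2)) := by
  rcases lt_or_ge N m with h | h
  · rw [jacobiCoeff_of_lt (by omega), jacobiCoeff_of_lt (by omega), jacobiCoeff_of_lt h,
      jacobiCoeff_of_lt (by omega)]
    ring
  obtain ⟨d, rfl⟩ := Nat.exists_eq_add_of_le h
  have hf := qFactorial_ne_zero hq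
  have hs := fun j => sub_ne_zero.2 (hq j).symm
  have e1 : jacobiCoeff q (m + d + 1) (m + 1) = (-1) ^ (m + 1) * q ^ (m * (m + 1) / 2 + (m + 1)) *
      (qFactorial q (2 * (m + d) + 1) * (1 - q ^ (2 * (m + d) + 1 + 1)) *
        (1 - q ^ (2 * (m + d) + 1 + 1 + 1)) / (qFactorial q d * (qFactorial q (m + d + m + 1) *
        (1 - q ^ (m + d + m + 1 + 1)) * (1 - q ^ (m + d + m + 1 + 1 + 1))))) := by
    rw [show m + d + 1 = m + 1 + d by ring, jacobiCoeff_add, triangle_succ_div,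
      ← qFactorial_succ, ← qFactorial_succ, ← qFactorial_succ, ← qFactorial_succ]
    ring_nf
  rw [e1, jacobiCoeff_add]
  have g1 := hf d
  have g2 := hf (m + d + m + 1)
  have g3 := hs (m + d + m + 1)
  have g4 := hs (m + d + m + 1 + 1)
  rcases d with _ | d
  · rw [jacobiCoeff_of_lt (by omega), jacobiCoeff_of_lt (by omega)]
    simp only [add_zero, ← two_mul] at *
    field_simp
    ring
  have e2 : jacobiCoeff q (m + (d + 1)) (m + 1) =
      (-1) ^ (m + 1) * q ^ (m * (m + 1) / 2 + (m + 1)) *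
      (qFactorial q (2 * (m + (d + 1)) + 1) * (1 - q ^ (d + 1)) / (qFactorial q (d + 1) *
      (qFactorial q (m + (d + 1) + m + 1) * (1 - q ^ (m + (d + 1) + m + 1 + 1))))) := by
    rw [← qFactorial_succ, show m + (d + 1) = m + 1 + d by ring, jacobiCoeff_add,
      triangle_succ_div, qFactorial_succ q d, show m + 1 + d + (m + 1) + 1 = m + 1 + d + m + 1 + 1
      by ring]
    have := hf d
    have := hs d
    have := hf (m + 1 + d + m + 1 + 1)
    field_simp
  have e3 : jacobiCoeff q (m + (d + 1)) (m + 2) =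
      (-1) ^ (m + 2) * q ^ (m * (m + 1) / 2 + (m + 1) + (m + 2)) *
      (qFactorial q (2 * (m + (d + 1)) + 1) * (1 - q ^ (d + 1)) * (1 - q ^ d) /
      (qFactorial q (d + 1) * (qFactorial q (m + (d + 1) + m + 1) *
      (1 - q ^ (m + (d + 1) + m + 1 + 1)) * (1 - q ^ (m + (d + 1) + m + 1 + 1 + 1))))) := by
    rcases d with _ | d
    · rw [jacobiCoeff_of_lt (by omega)]
      simp
    rw [← qFactorial_succ, ← qFactorial_succ, show m + (d + 1 + 1) = m + 2 + d by ring,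
      jacobiCoeff_add, show m + 2 + 1 = m + 1 + 1 + 1 by ring, show m + 2 = m + 1 + 1 by ring,
      triangle_succ_div, triangle_succ_div, qFactorial_succ q (d + 1), qFactorial_succ q d,
      show m + 1 + 1 + d + (m + 1 + 1) + 1 = m + 1 + 1 + d + m + 1 + 1 + 1 by ring]
    have := hf d
    have := hs d
    have := hs (d + 1)
    have := hf (m + 1 + 1 + d + m + 1 + 1 + 1)
    field_simp
  rw [e2, e3]
  field_simp
  ring

theorem jacobiCoeff_succ_zero (hq : ∀ j, q ^ (j + 1) ≠ 1) (N : ℕ) :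
    jacobiCoeff q (N + 1) 0 = (1 + (q ^ (N + 1)) ^ 2) * jacobiCoeff q N 0 -
      q ^ (N + 1) * (jacobiCoeff q N 1 - jacobiCoeff q N 0) := by
  have hf := qFactorial_ne_zero hq
  have hs := fun j => sub_ne_zero.2 (hq j).symm
  have e0 := jacobiCoeff_add (q := q) 0 N
  have e1 := jacobiCoeff_add (q := q) 0 (N + 1)
  have e2 : jacobiCoeff q N 1 = -q * (qFactorial q (2 * N + 1) * (1 - q ^ N) /
      (qFactorial q N * qFactorial q (N + 1 + 1))) := by
    rcases N with _ | N
    · rw [jacobiCoeff_of_lt (by omega)]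
      simp
    rw [add_comm N 1, jacobiCoeff_add, add_comm 1 N, qFactorial_succ q N]
    have := hf N
    have := hs N
    have := hf (N + 1 + 1 + 1)
    field_simp
    ring
  simp only [zero_add, add_zero, pow_zero, one_mul] at e0 e1
  rw [e1, e0, e2, show 2 * (N + 1) + 1 = 2 * N + 1 + 1 + 1 by ring,
    qFactorial_succ q (2 * N + 1 + 1),
    qFactorial_succ q (2 * N + 1), qFactorial_succ q (N + 1), qFactorial_succ q N]
  have := hf N
  have := hs N
  have := hs (N + 1)
  simp
  field_simp
  ring

theorem prod_jacobi (hq : ∀ j, q ^ (j + 1) ≠ 1) (N : ℕ) :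
    ∏ n ∈ range N, (C ((1 - q ^ (n + 1)) ^ 2) - C (q ^ (n + 1)) * X) =
      ∑ m ∈ range (N + 1), C (jacobiCoeff q N m) * jacobiPoly K m := by
  induction N with
  | zero =>
    have := sub_ne_zero.2 (hq 0).symm
    simp [jacobiCoeff, jacobiPoly, qFactorial_succ, qFactorial_zero]
    rw [zero_add, pow_one] at this
    rw [div_self this, map_one]
  | succ N ih =>
    have hX := X_add_two_mul_sum_jacobiPoly (c := jacobiCoeff q N) fun m h => jacobiCoeff_of_lt h
    have hlow := sum_range_succ' (fun m => C (jacobiCoeff q N m) * jacobiPoly K m) (N + 1)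
    rw [sum_range_succ, jacobiCoeff_of_lt (Nat.lt_succ_self N), map_zero, zero_mul,
      add_zero] at hlow
    have hterm : ∀ m ∈ range (N + 1), C (jacobiCoeff q (N + 1) (m + 1)) * jacobiPoly K (m + 1) =
        C (1 + (q ^ (N + 1)) ^ 2) * (C (jacobiCoeff q N (m + 1)) * jacobiPoly K (m + 1)) -
        C (q ^ (N + 1)) * (C (jacobiCoeff q N m + jacobiCoeff q N (m + 2)) *
          jacobiPoly K (m + 1)) := by
      intro m _
      rw [jacobiCoeff_succ_succ hq, map_sub, map_mul, map_mul]
      ring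
    rw [prod_range_succ, ih, sum_range_succ' _ (N + 1), sum_congr rfl hterm, sum_sub_distrib,
      ← mul_sum, ← mul_sum, jacobiCoeff_succ_zero hq, ← sub_eq_of_eq_add hlow,
      ← sub_eq_of_eq_add' hX]
    simp only [map_sub, map_add, map_mul, map_pow, map_one]
    ring

end JacobiPolynomial

section JacobiSeries

open PowerSeries

variable {F : Type*} [Field F]

local notation "ι" => algebraMap F⟦X⟧ (FractionRing F⟦X⟧)

/-- The ratio `(q)_N (q)_{2 N + 1} / ((q)_{N-m} (q)_{N+m+1})` for `N = m + d`. -/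
noncomputable def jacobiRatio (F : Type*) [Field F] (m d : ℕ) : F⟦X⟧ :=
  (qFactorial X (m + d) * (qFactorial X d)⁻¹) *
    (qFactorial X (2 * (m + d) + 1) * (qFactorial X (m + d + m + 1))⁻¹)

/-- The summand of the theta series `J k = E ^ 3 * Ψ k`. -/
noncomputable def jacobiTerm (F : Type*) [Field F] (k m : ℕ) : F⟦X⟧ :=
  (-1) ^ m * X ^ (m * (m + 1) / 2) * (jacobiNumber k m : F⟦X⟧)

theorem X_pow_dvd_qFactorial_mul_inv_sub (d e : ℕ) :
    (X : F⟦X⟧) ^ (d + 1) ∣ qFactorial X (d + e) * (qFactorial X d)⁻¹ - 1 := by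
  rw [← qFactorial_mul_inv d, ← sub_mul]
  exact (X_pow_dvd_qFactorial_sub d e).mul_right _

theorem X_pow_dvd_jacobiRatio_sub (m d : ℕ) : X ^ (d + 1) ∣ jacobiRatio F m d - 1 := by
  have h1 := X_pow_dvd_qFactorial_mul_inv_sub (F := F) d m
  have h2 := X_pow_dvd_qFactorial_mul_inv_sub (F := F) (m + d + m + 1) d
  rw [add_comm d m] at h1
  rw [show m + d + m + 1 + d = 2 * (m + d) + 1 by ring] at h2
  rw [jacobiRatio, ← sub_add_sub_cancel _ (qFactorial X (2 * (m + d) + 1) *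
    (qFactorial X (m + d + m + 1))⁻¹), ← sub_one_mul]
  exact dvd_add (h1.mul_right _) ((pow_dvd_pow _ (by omega)).trans h2)

theorem X_pow_dvd_jacobiTerm (k m : ℕ) : X ^ m ∣ jacobiTerm F k m := by
  have h : m ≤ m * (m + 1) / 2 := by
    rcases m with _ | m
    · simp
    · rw [triangle_succ_div]; omega
  exact (((pow_dvd_pow _ h).mul_left _).mul_right _)

theorem euler_jacobiTerm (k m : ℕ) : 2 * euler F (jacobiTerm F k m) =
    (2 * k + 3) * (2 * k + 2) * jacobiTerm F (k + 1) m + k * (k + 1) * jacobiTerm F k m := by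
  have h1 : euler F ((-1) ^ m) = 0 := by
    rcases neg_one_pow_eq_or F⟦X⟧ m with h | h <;> simp [h]
  have h2 : euler F (jacobiNumber k m : F⟦X⟧) = 0 := (euler F).map_natCast _
  have h3 := congrArg (Int.cast : ℤ → F⟦X⟧) (jacobiNumber_heat k m)
  have h4 : ((m * (m + 1) / 2 : ℕ) : F⟦X⟧) * 2 = m * (m + 1) := by
    exact_mod_cast congrArg (Nat.cast : ℕ → F⟦X⟧)
      (Nat.div_mul_cancel (Nat.even_mul_succ_self m).two_dvd)
  push_cast at h3
  rw [jacobiTerm, jacobiTerm, Derivation.leibniz, Derivation.leibniz, h1, h2, euler_X_pow]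
  simp only [smul_eq_mul]
  linear_combination (-1) ^ m * X ^ (m * (m + 1) / 2) * h3 +
    (-1) ^ m * X ^ (m * (m + 1) / 2) * (jacobiNumber k m : F⟦X⟧) * h4

theorem qFactorial_pow_mul_coeff_prod (N k : ℕ) :
    qFactorial X N ^ 3 * coeff k (∏ n ∈ range N, (1 - C (nodeSeries F n) * X)) =
      ∑ m ∈ range (N + 1), jacobiTerm F k m * jacobiRatio F m (N - m) := by
  have hq := algebraMap_X_pow_ne_one (F := F)
  have hs := fun j => sub_ne_zero.2 (hq j).symm
  apply algebraMap_injective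
  have hmap := coeff_map ι k (∏ n ∈ range N, (1 - C (nodeSeries F n) * X))
  simp only [map_prod, map_sub, map_one, map_mul, map_C, map_X, algebraMap_nodeSeries] at hmap
  have hprod : ∏ n ∈ range N, (C ((1 - ι X ^ (n + 1)) ^ 2) - C (ι X ^ (n + 1)) * X) =
      C (qFactorial (ι X) N ^ 2) * ∏ n ∈ range N, (1 - C (node (ι X) (n + 1)) * X) := by
    rw [qFactorial, ← prod_pow, map_prod, ← prod_mul_distrib]
    refine prod_congr rfl fun n _ => ?_
    rw [mul_sub, mul_one, ← mul_assoc, ← map_mul, node, mul_div_cancel₀ _ (pow_ne_zero 2 (hs n))]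
  have hpoly := congrArg (Polynomial.coeff · k) (prod_jacobi hq N)
  have hcoe : ((∏ n ∈ range N, (Polynomial.C ((1 - ι X ^ (n + 1)) ^ 2) -
      Polynomial.C (ι X ^ (n + 1)) * Polynomial.X) : Polynomial (FractionRing F⟦X⟧)) :
      (FractionRing F⟦X⟧)⟦X⟧) =
      ∏ n ∈ range N, (C ((1 - ι X ^ (n + 1)) ^ 2) - C (ι X ^ (n + 1)) * X) := by
    rw [← Polynomial.coeToPowerSeries.ringHom_apply, map_prod]
    refine prod_congr rfl fun n _ => ?_
    simp
  simp only [Polynomial.finsetSum_coeff, Polynomial.coeff_C_mul, coeff_jacobiPoly] at hpoly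
  rw [← Polynomial.coeff_coe, hcoe, hprod, coeff_C_mul, hmap] at hpoly
  rw [map_mul, map_pow, map_qFactorial, pow_succ', mul_assoc, hpoly, mul_sum, map_sum]
  refine sum_congr rfl fun m hm => ?_
  obtain ⟨d, rfl⟩ := Nat.exists_eq_add_of_le (Nat.lt_succ_iff.1 (mem_range.1 hm))
  rw [jacobiCoeff_add, Nat.add_sub_cancel_left, jacobiTerm, jacobiRatio]
  simp only [map_mul, map_pow, map_neg, map_one, map_natCast, map_qFactorial]
  rw [algebraMap_inv (by simp [constantCoeff_qFactorial]),
    algebraMap_inv (by simp [constantCoeff_qFactorial])]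
  simp only [map_qFactorial]
  rw [div_eq_mul_inv, mul_inv]
  ring

theorem tends_qFactorial : Tends (fun N => (qFactorial X N : F⟦X⟧)) (pentagonalSeries F) := by
  intro N
  rw [X_pow_dvd_iff]
  intro k hk
  obtain ⟨s, hs⟩ := Filter.eventually_atTop.1 (coeff_prod_one_sub_X_pow_eventually_eq F k)
  obtain ⟨M, hM⟩ := s.exists_nat_subset_range
  have h1 := hs (range (N + M)) (hM.trans (range_subset_range.2 (by omega)))
  have h2 := X_pow_dvd_iff.1 (X_pow_dvd_qFactorial_sub (F := F) N M) k hk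
  rw [map_sub, sub_eq_zero] at h2
  rw [map_sub, ← h1, ← h2, qFactorial, sub_self]

theorem constantCoeff_pentagonalSeries : constantCoeff (pentagonalSeries F) = 1 := by
  have := (tends_qFactorial (F := F)).coeff_eq le_rfl (k := 0)
  rw [← coeff_zero_eq_constantCoeff_apply, ← this, qFactorial_zero, coeff_zero_one]

theorem pentagonalSeries_mul_inv : pentagonalSeries F * (pentagonalSeries F)⁻¹ = 1 :=
  PowerSeries.mul_inv_cancel _ (by simp [constantCoeff_pentagonalSeries])

theorem tends_qFactorial_inv :
    Tends (fun N => (qFactorial X N : F⟦X⟧)⁻¹) (pentagonalSeries F)⁻¹ := by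
  intro N
  have h : (qFactorial X N : F⟦X⟧)⁻¹ - (pentagonalSeries F)⁻¹ =
      (qFactorial X N - pentagonalSeries F) *
        (-(qFactorial X N)⁻¹ * (pentagonalSeries F)⁻¹) := by
    linear_combination (pentagonalSeries F)⁻¹ * qFactorial_mul_inv (F := F) N -
      (qFactorial X N)⁻¹ * pentagonalSeries_mul_inv (F := F)
  rw [h]
  exact (tends_qFactorial N).mul_right _

theorem exists_tends_jacobiTerm (k : ℕ) :
    ∃ J, Tends (fun N => ∑ m ∈ range (N + 1), jacobiTerm F k m) J := by
  refine Tends.of_succ fun N => ?_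
  rw [sum_range_succ _ (N + 1), add_sub_cancel_left]
  exact X_pow_dvd_jacobiTerm k (N + 1)

theorem tends_coeff_prod {k : ℕ} {J : F⟦X⟧}
    (hJ : Tends (fun N => ∑ m ∈ range (N + 1), jacobiTerm F k m) J) :
    Tends (fun N => coeff k (∏ n ∈ range N, (1 - C (nodeSeries F n) * X)))
      ((pentagonalSeries F)⁻¹ ^ 3 * J) := by
  have h1 : Tends (fun N => qFactorial X N ^ 3 *
      coeff k (∏ n ∈ range N, (1 - C (nodeSeries F n) * X))) J := by
    refine hJ.congr fun N => ?_
    rw [qFactorial_pow_mul_coeff_prod, ← sum_sub_distrib]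
    refine dvd_sum fun m hm => ?_
    obtain ⟨d, rfl⟩ := Nat.exists_eq_add_of_le (Nat.lt_succ_iff.1 (mem_range.1 hm))
    rw [Nat.add_sub_cancel_left, ← mul_sub_one, add_assoc m, pow_add]
    exact mul_dvd_mul (X_pow_dvd_jacobiTerm k m) (X_pow_dvd_jacobiRatio_sub m d)
  have h2 := ((tends_qFactorial_inv (F := F)).mul
    ((tends_qFactorial_inv (F := F)).mul (tends_qFactorial_inv (F := F)))).mul h1
  convert h2 using 1
  · ext1 N
    have := qFactorial_mul_inv (F := F) N
    generalize (qFactorial X N : F⟦X⟧)⁻¹ = b at *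
    generalize (qFactorial X N : F⟦X⟧) = a at *
    have h3 : a ^ 3 * b ^ 3 = 1 := by rw [← mul_pow, this, one_pow]
    linear_combination -coeff k (∏ n ∈ range N, (1 - C (nodeSeries F n) * X)) * h3
  · ring

theorem heat_of_tends {k : ℕ} {J J' : F⟦X⟧}
    (hJ : Tends (fun N => ∑ m ∈ range (N + 1), jacobiTerm F k m) J)
    (hJ' : Tends (fun N => ∑ m ∈ range (N + 1), jacobiTerm F (k + 1) m) J') :
    2 * euler F J = (2 * (k : F⟦X⟧) + 3) * (2 * (k : F⟦X⟧) + 2) * J' +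
      (k : F⟦X⟧) * ((k : F⟦X⟧) + 1) * J := by
  refine (hJ.euler.const_mul 2).unique ?_
  have h := (hJ'.const_mul ((2 * (k : F⟦X⟧) + 3) * (2 * (k : F⟦X⟧) + 2))).add
    (hJ.const_mul ((k : F⟦X⟧) * ((k : F⟦X⟧) + 1)))
  refine h.congr fun N => ?_
  rw [map_sum, mul_sum, mul_sum, mul_sum, ← sum_add_distrib, ← sum_sub_distrib]
  refine dvd_sum fun m _ => ?_
  rw [euler_jacobiTerm, sub_self]
  exact dvd_zero _

theorem coeff_zero_prod (N : ℕ) :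
    coeff 0 (∏ n ∈ range N, (1 - C (nodeSeries F n) * X)) = 1 := by
  simp [map_prod]

theorem coeff_one_prod (N : ℕ) :
    coeff 1 (∏ n ∈ range N, (1 - C (nodeSeries F n) * X)) =
      -∑ n ∈ range N, nodeSeries F n := by
  induction N with
  | zero => simp [coeff_one]
  | succ N ih =>
    rw [prod_range_succ, mul_sub, mul_one, map_sub, ih, mul_comm, mul_assoc, coeff_C_mul,
      show (1 : ℕ) = 0 + 1 from rfl, coeff_succ_X_mul, coeff_zero_prod, sum_range_succ]
    ring

theorem tends_coeff_prod_pow_four {Ψ : ℕ → F⟦X⟧}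
    (h : ∀ k, Tends (fun N => coeff k (∏ n ∈ range N, (1 - C (nodeSeries F n) * X))) (Ψ k))
    (k : ℕ) : Tends (fun N => coeff k ((∏ n ∈ range N, (1 - C (nodeSeries F n) * X)) ^ 4))
      (coeff k (mk Ψ ^ 4)) := by
  have hmul : ∀ {f g : ℕ → F⟦X⟧⟦X⟧} {a b : F⟦X⟧⟦X⟧},
      (∀ k, Tends (fun N => coeff k (f N)) (coeff k a)) →
      (∀ k, Tends (fun N => coeff k (g N)) (coeff k b)) →
      ∀ k, Tends (fun N => coeff k (f N * g N)) (coeff k (a * b)) := by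
    intro f g a b hf hg k
    simp only [coeff_mul]
    exact Tends.sum _ fun p _ => (hf p.1).mul (hg p.2)
  have h1 : ∀ k, Tends (fun N => coeff k (∏ n ∈ range N, (1 - C (nodeSeries F n) * X)))
      (coeff k (mk Ψ)) := fun k => by rw [coeff_mk]; exact h k
  have h2 := hmul (hmul h1 h1) (hmul h1 h1) k
  simp only [← pow_two, ← pow_mul] at h2
  exact h2

end JacobiSeries

section ModSeven

open PowerSeries

variable {F : Type*} [Field F]

theorem coeff_pow_four_pentagonalSeries (h7 : CharP F 7) (n : ℕ) :
    (3 * (n : F) + 1) ^ 4 * coeff n (pentagonalSeries F) =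
      (3 * (n : F) + 1) * coeff n (pentagonalSeries F) := by
  by_cases h : n ∈ Set.range pentagonal
  · obtain ⟨k, rfl⟩ := h
    congr 1
    have h1 := congrArg (Int.cast : ℤ → ZMod 7) (two_mul_natCast_pentagonal k)
    have h2 : (3 * (pentagonal k : ZMod 7) + 1) ^ 4 = 3 * (pentagonal k : ZMod 7) + 1 := by
      push_cast at h1
      generalize (pentagonal k : ZMod 7) = x at h1 ⊢
      generalize (k : ZMod 7) = y at h1
      revert x y
      decide
    have h3 := congrArg (ZMod.castHom dvd_rfl F) h2
    simpa only [map_pow, map_add, map_mul, map_natCast, map_ofNat, map_one] using h3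
  · rw [coeff_pentagonalSeries_eq_zero F h, mul_zero, mul_zero]

theorem charP_powerSeries (h7 : CharP F 7) : CharP F⟦X⟧ 7 :=
  charP_of_injective_algebraMap (R := F) C_injective 7

theorem euler_ofNat (n : ℕ) [n.AtLeastTwo] : euler F (ofNat(n) : F⟦X⟧) = 0 := by
  rw [← Nat.cast_ofNat (n := n), (euler F).map_natCast]

theorem euler_ofNat_mul (n : ℕ) [n.AtLeastTwo] (f : F⟦X⟧) :
    euler F (ofNat(n) * f) = ofNat(n) * euler F f := by
  rw [Derivation.leibniz, euler_ofNat, smul_zero, add_zero, smul_eq_mul]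

theorem sq_eq_of_pentagonal (h7 : CharP F 7) {a b P Q : F⟦X⟧}
    (hE : euler F (pentagonalSeries F) = pentagonalSeries F * a)
    (ha : euler F a = 3 * b + a - 3 * a ^ 2) (hb : euler F b = 3 * b - 3 * a * b)
    (hP : P = 1 + 3 * a) (hQ : Q = 1 + 5 * a + 5 * a ^ 2 + 4 * b) : Q ^ 2 = P := by
  have := charP_powerSeries h7
  have hθP : 3 * euler F P = 2 * (P ^ 2 - Q) := by
    rw [hP, map_add, Derivation.map_one_eq_zero, euler_ofNat_mul, ha, hQ, ← sub_eq_zero]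
    ring_nf
    reduce_mod_char!
  have hθQ : 3 * euler F Q = P * Q - 1 := by
    rw [hQ, hP]
    simp only [map_add, Derivation.map_one_eq_zero, euler_ofNat, pow_two, Derivation.leibniz,
      smul_eq_mul, ha, hb]
    rw [← sub_eq_zero]
    ring_nf
    reduce_mod_char!
  have hT : ∀ f : F⟦X⟧, 3 * euler F (pentagonalSeries F * f) + pentagonalSeries F * f =
      pentagonalSeries F * (3 * euler F f + P * f) := by
    intro f
    rw [Derivation.leibniz, smul_eq_mul, smul_eq_mul, hE, hP]
    ring
  have hcoeff : ∀ (n : ℕ) (f : F⟦X⟧),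
      coeff n (3 * euler F f + f) = (3 * (n : F) + 1) * coeff n f := by
    intro n f
    rw [map_add, show (3 : F⟦X⟧) = C (3 : F) from (map_ofNat C 3).symm, coeff_C_mul, coeff_euler]
    ring
  have h1 := hT 1
  rw [mul_one, mul_one, Derivation.map_one_eq_zero, mul_zero, zero_add] at h1
  have h2 := hT P
  rw [hθP, show 2 * (P ^ 2 - Q) + P * P = 3 * P ^ 2 - 2 * Q by ring] at h2
  have h3 := hT (3 * P ^ 2 - 2 * Q)
  have e3 : 3 * euler F (3 * P ^ 2 - 2 * Q) + P * (3 * P ^ 2 - 2 * Q) = P ^ 3 - 2 * P * Q + 2 := by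
    simp only [map_sub, euler_ofNat, pow_two, Derivation.leibniz, smul_eq_mul]
    rw [← sub_eq_zero]
    trans 6 * P * (3 * euler F P - 2 * (P ^ 2 - Q)) - 2 * (3 * euler F Q - (P * Q - 1))
    · rw [← sub_eq_zero]
      ring_nf
      reduce_mod_char!
    · rw [hθP, hθQ]
      ring
  rw [e3] at h3
  have h4 := hT (P ^ 3 - 2 * P * Q + 2)
  have e4 : 3 * euler F (P ^ 3 - 2 * P * Q + 2) + P * (P ^ 3 - 2 * P * Q + 2) =
      4 * Q ^ 2 + 4 * P := by
    simp only [map_add, map_sub, euler_ofNat, Derivation.leibniz_pow, Derivation.leibniz,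
      smul_eq_mul,
      nsmul_eq_mul, Nat.cast_ofNat]
    rw [← sub_eq_zero]
    trans (3 * P ^ 2 - 2 * Q) * (3 * euler F P - 2 * (P ^ 2 - Q)) -
      2 * P * (3 * euler F Q - (P * Q - 1))
    · rw [← sub_eq_zero]
      ring_nf
      reduce_mod_char!
    · rw [hθP, hθQ]
      ring
  rw [e4] at h4
  have h5 : pentagonalSeries F * (4 * Q ^ 2 + 4 * P) = pentagonalSeries F * P := by
    ext n
    have hc := congrArg (coeff n) h1
    rw [hcoeff] at hc
    rw [← h4, hcoeff, ← h3, hcoeff, ← h2, hcoeff, ← hc]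
    linear_combination coeff_pow_four_pentagonalSeries h7 n
  have hE0 : pentagonalSeries F ≠ 0 := by
    intro h
    have := constantCoeff_pentagonalSeries (F := F)
    rw [h, map_zero] at this
    exact zero_ne_one this
  have h6 := mul_left_cancel₀ hE0 h5
  rw [← sub_eq_zero]
  trans 2 * (4 * Q ^ 2 + 4 * P - P)
  · rw [← sub_eq_zero]
    ring_nf
    reduce_mod_char!
  · rw [h6, sub_self, mul_zero]

end ModSeven

section Exactness

open PowerSeries

variable {F : Type*} [Field F]

theorem coeff_mk_pow_four {Ψ : ℕ → F⟦X⟧} (h0 : Ψ 0 = 1) :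
    coeff 2 (mk Ψ ^ 4) = 4 * Ψ 2 + 6 * Ψ 1 ^ 2 ∧
    coeff 3 (mk Ψ ^ 4) = 4 * Ψ 3 + 12 * Ψ 1 * Ψ 2 + 4 * Ψ 1 ^ 3 ∧
    coeff 4 (mk Ψ ^ 4) =
      4 * Ψ 4 + 12 * Ψ 1 * Ψ 3 + 6 * Ψ 2 ^ 2 + 12 * Ψ 1 ^ 2 * Ψ 2 + Ψ 1 ^ 4 := by
  have h : mk Ψ ^ 4 = mk Ψ * mk Ψ * (mk Ψ * mk Ψ) := by ring
  rw [h]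
  refine ⟨?_, ?_, ?_⟩ <;>
  · simp only [coeff_mul, Nat.sum_antidiagonal_eq_sum_range_succ_mk, sum_range_succ, range_zero,
      sum_empty, coeff_mk, h0, Nat.sub_self, Nat.sub_zero, Nat.reduceSub]
    ring

theorem euler_sub_mul_eq (h7 : CharP F 7) {a b c d Q : F⟦X⟧}
    (ha : euler F a = 3 * b + a - 3 * a ^ 2) (hb : euler F b = 3 * b - 3 * a * b)
    (hc : euler F c = d + 6 * c - 3 * a * c)
    (hQ : Q = 1 + 5 * a + 5 * a ^ 2 + 4 * b) (hQP : Q ^ 2 = 1 + 3 * a)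
    {W : F⟦X⟧} (hW : W = 1 + 20 * Q - (c + 2 * Q ^ 2 + 6 * Q ^ 3 + Q ^ 4 + 5 * Q ^ 6)) :
    euler F W - a * W - 5 * W + a = -((4 * b + 6 * a ^ 2) +
      2 * (4 * c + 12 * a * b + 4 * a ^ 3) +
      2 * (4 * d + 12 * a * c + 6 * b ^ 2 + 12 * a ^ 2 * b + a ^ 4)) := by
  have := charP_powerSeries h7
  have ha' : a = 5 * (Q ^ 2 - 1) := by
    rw [hQP, ← sub_eq_zero]
    ring_nf
    reduce_mod_char!
  have hb' : b = 2 * (Q - 1 - 5 * a - 5 * a ^ 2) := by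
    rw [hQ, ← sub_eq_zero]
    ring_nf
    reduce_mod_char!
  have hθQ : euler F Q = 5 * (Q ^ 3 - 1) := by
    rw [pow_succ, hQP, hQ]
    simp only [map_add, Derivation.map_one_eq_zero, euler_ofNat, pow_two, Derivation.leibniz,
      smul_eq_mul, ha, hb]
    rw [← sub_eq_zero]
    ring_nf
    reduce_mod_char!
  have hθW : euler F W = 20 * (5 * (Q ^ 3 - 1)) - (d + 6 * c - 3 * a * c +
      (4 * Q + 18 * Q ^ 2 + 4 * Q ^ 3 + 30 * Q ^ 5) * (5 * (Q ^ 3 - 1))) := by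
    rw [hW]
    simp only [map_add, map_sub, Derivation.map_one_eq_zero, euler_ofNat, Derivation.leibniz_pow,
      Derivation.leibniz, smul_eq_mul, nsmul_eq_mul, Nat.cast_ofNat, Nat.reduceSub, hθQ, hc]
    ring
  rw [hθW, hW, hb', ha', ← sub_eq_zero]
  ring_nf
  reduce_mod_char!

theorem add_eq_euler_sub_mul (h7 : CharP F 7) {a V r₀ r₁ r₂ L p₂ p₃ p₄ : F⟦X⟧} (hL : L = -a)
    (h0 : 2 * p₂ = r₁ + euler F r₀ + L * r₀) (h1 : 2 * p₃ = r₂ - 2 * r₁ + euler F r₁ + L * r₁)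
    (h2 : 2 * p₄ = r₂ + euler F r₂ + L * r₂)
    (hV : euler F V - a * V - 5 * V + a = -(p₂ + 2 * p₃ + 2 * p₄)) :
    L + r₀ = euler F (V + 4 * r₀ + r₁ + r₂) - a * (V + 4 * r₀ + r₁ + r₂) -
      5 * (V + 4 * r₀ + r₁ + r₂) := by
  have := charP_powerSeries h7
  have h7' : (7 : F⟦X⟧) = 0 := CharP.ofNat_eq_zero F⟦X⟧ 7
  rw [map_add, map_add, map_add, euler_ofNat_mul]
  subst hL
  linear_combination -hV + 4 * h0 + h1 + h2 + (3 * r₀ + r₁ + r₂ - p₂) * h7'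

/-- Modulo 7, the generating function of `spt` is `(q d/dq - 5) f` for some power series `f`. -/
theorem exists_mk_spt_eq (h7 : CharP F 7) :
    ∃ f : F⟦X⟧, mk (fun m => (spt m : F)) = euler F f - 5 * f := by
  have := charP_powerSeries h7
  choose J hJ using exists_tends_jacobiTerm (F := F)
  set E := pentagonalSeries F with hE
  set u := E⁻¹ with hu
  have hEu : E * u = 1 := pentagonalSeries_mul_inv
  set Ψ : ℕ → F⟦X⟧ := fun k => u ^ 3 * J k with hΨ
  have hlim : ∀ k, Tends (fun N => coeff k (∏ n ∈ range N, (1 - C (nodeSeries F n) * X))) (Ψ k) :=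
    fun k => tends_coeff_prod (hJ k)
  have hΨ0 : Ψ 0 = 1 := by
    refine (hlim 0).unique ?_
    simp only [coeff_zero_prod]
    exact Tends.const 1
  have hL : Tends (fun N => ∑ n ∈ range N, nodeSeries F n) (-Ψ 1) := by
    have h := (hlim 1).neg
    simpa only [coeff_one_prod, neg_neg] using h
  have hJΨ : ∀ k, J k = E ^ 3 * Ψ k := fun k => by
    rw [hΨ, ← mul_assoc, ← mul_pow, hEu, one_pow, one_mul]
  have hunit : ∀ {x y : F⟦X⟧}, E * x = E * y → x = y := fun {x y} h => by
    linear_combination u * h + (y - x) * hEu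
  have hcancel : ∀ {x y : F⟦X⟧}, E ^ 3 * x = E ^ 3 * y → x = y := fun {x y} h =>
    hunit (hunit (hunit (by linear_combination h)))
  have hθJ : ∀ k, euler F (J k) = E ^ 2 * (3 * euler F E * Ψ k + E * euler F (Ψ k)) := fun k => by
    rw [hJΨ]
    simp only [Derivation.leibniz, Derivation.leibniz_pow, smul_eq_mul, nsmul_eq_mul]
    push_cast
    ring
  have h70 : (7 : F⟦X⟧) = 0 := CharP.ofNat_eq_zero F⟦X⟧ 7
  have hθE : euler F E = E * Ψ 1 := by
    have h := heat_of_tends (hJ 0) (hJ 1)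
    rw [hθJ, hJΨ, hJΨ, hΨ0, Derivation.map_one_eq_zero] at h
    refine hunit (hunit ?_)
    push_cast at h
    linear_combination -h + (E ^ 2 * euler F E - E ^ 3 * Ψ 1) * h70
  have hheat : ∀ k : ℕ, 2 * (3 * Ψ 1 * Ψ k + euler F (Ψ k)) =
      (2 * (k : F⟦X⟧) + 3) * (2 * (k : F⟦X⟧) + 2) * Ψ (k + 1) +
        (k : F⟦X⟧) * ((k : F⟦X⟧) + 1) * Ψ k := fun k => by
    have h := heat_of_tends (hJ k) (hJ (k + 1))
    rw [hθJ, hJΨ, hJΨ, hθE] at h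
    exact hcancel (by linear_combination h)
  have hθ1 : euler F (Ψ 1) = 3 * Ψ 2 + Ψ 1 - 3 * Ψ 1 ^ 2 := by
    have h := hheat 1
    push_cast at h
    linear_combination 4 * h + (11 * Ψ 2 + Ψ 1 - 3 * Ψ 1 ^ 2 - euler F (Ψ 1)) * h70
  have hθ2 : euler F (Ψ 2) = 3 * Ψ 2 - 3 * Ψ 1 * Ψ 2 := by
    have h := hheat 2
    push_cast at h
    linear_combination 4 * h + (24 * Ψ 3 + 3 * Ψ 2 - 3 * Ψ 1 * Ψ 2 - euler F (Ψ 2)) * h70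
  have hθ3 : euler F (Ψ 3) = Ψ 4 + 6 * Ψ 3 - 3 * Ψ 1 * Ψ 3 := by
    have h := hheat 3
    push_cast at h
    linear_combination 4 * h + (41 * Ψ 4 + 6 * Ψ 3 - 3 * Ψ 1 * Ψ 3 - euler F (Ψ 3)) * h70
  choose r hr using fun j => Tends.of_sum (F := F)
    (f := fun n => appellTerm F n * nodeSeries F n ^ j)
    fun n => (X_pow_dvd_appellTerm n).mul_right _
  obtain ⟨e2, e3, e4⟩ := coeff_mk_pow_four hΨ0
  have hΦ := tends_coeff_prod_pow_four hlim
  have m0 := two_mul_eq_moments h7 (j := 0) (by norm_num) hL hr (hΦ 2)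
  have m1 := two_mul_eq_moments h7 (j := 1) (by norm_num) hL hr (hΦ 3)
  have m2 := two_mul_eq_moments h7 (j := 2) (by norm_num) hL hr (hΦ 4)
  rw [e2] at m0
  rw [e3] at m1
  rw [e4] at m2
  push_cast at m0 m1 m2
  have hQP := sq_eq_of_pentagonal h7 hθE hθ1 hθ2 rfl rfl
  have hV := euler_sub_mul_eq h7 hθ1 hθ2 hθ3 rfl hQP rfl
  have hW := add_eq_euler_sub_mul h7 (r₀ := r 0) (r₁ := r 1) (r₂ := r 2) rfl
    (by linear_combination m0 + (Ψ 1 * r 0 - r 1 - euler F (r 0)) * h70)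
    (by linear_combination m1 + (Ψ 1 * r 1 - 3 * r 2 - euler F (r 1)) * h70)
    (by linear_combination m2 + (Ψ 1 * r 2 - 6 * r 3 - r 2 - euler F (r 2)) * h70) hV
  have hr0 : Tends (fun N => ∑ n ∈ range N, appellTerm F n) (r 0) := by
    simpa only [pow_zero, mul_one] using hr 0
  have hspt := pentagonalSeries_mul_mk_spt (tends_sum_qFactorial_geom hL hr0)
  have hθu : euler F u = -(u * Ψ 1) := by
    have h := congrArg (euler F) hEu
    rw [Derivation.leibniz, Derivation.map_one_eq_zero, smul_eq_mul, smul_eq_mul, hθE] at h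
    linear_combination u * h - (euler F u + u * Ψ 1) * hEu
  rw [hW] at hspt
  generalize _ + 4 * r 0 + r 1 + r 2 = W at hspt
  refine ⟨W * u, hunit ?_⟩
  rw [hspt, Derivation.leibniz, hθu, smul_eq_mul, smul_eq_mul]
  linear_combination -(euler F W - Ψ 1 * W - 5 * W) * hEu

end Exactness

end SptModSeven

/-- Andrews' congruence for `spt` modulo 5. -/
theorem spt_congruence_mod_seven (n : ℕ) (h : 24 ∣ 7 * n + 1) :
    7 ∣ spt ((7 * n + 1) / 24) := by
  obtain ⟨m, hm⟩ := h
  rw [hm, Nat.mul_div_cancel_left m (by norm_num), ← ZMod.natCast_eq_zero_iff]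
  have : Fact (Nat.Prime 7) := ⟨by norm_num⟩
  obtain ⟨f, hf⟩ := SptModSeven.exists_mk_spt_eq (F := ZMod 7) (ZMod.charP 7)
  have hm5 : (m : ZMod 7) = 5 := by
    have : m % 7 = 5 := by omega
    rw [← ZMod.natCast_mod, this, Nat.cast_ofNat]
  have h := congrArg (PowerSeries.coeff m) hf
  rw [PowerSeries.coeff_mk, map_sub, SptModSeven.coeff_euler, hm5,
    show (5 : PowerSeries (ZMod 7)) = PowerSeries.C 5 from (map_ofNat _ 5).symm,
    PowerSeries.coeff_C_mul, sub_self] at h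
  exact h
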